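/- arXiv:1603.05523 — 4 statements merged into one kernel-verified Lean document; each statement's English description precedes it below -/
import Mathlib

section
/- Let d be a positive integer, let ε ∈ (0,1), and let n be a positive integer with the inscribed-polytope property for (d, ε). Set m = d·n. If X_1, X_2, …, X_m are sets in ℝ^d and K is a compact convex set of volume 1 with K ⊆ conv(X_i) for every i = 1, …, m, then one can choose points x_1 ∈ X_1, x_2 ∈ X_2, …, x_m ∈ X_m such that vol(conv{x_1, x_2, …, x_m}) ≥ 1 − ε. -/
open MeasureTheory

/-- A positive integer `n` has the inscribed-polytope property for `(d, ε)` if for every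
compact convex set `K ⊆ ℝ^d` of positive volume there is a finite set `Y ⊆ K` with
`|Y| ≤ n` such that `vol(conv Y) ≥ (1 - ε)·vol(K)`. -/
def InscribedPolytopeProp (d n : ℕ) (ε : ℝ) : Prop :=
  ∀ K : Set (EuclideanSpace ℝ (Fin d)), IsCompact K → Convex ℝ K → 0 < volume K →
    ∃ Y : Finset (EuclideanSpace ℝ (Fin d)), (Y : Set (EuclideanSpace ℝ (Fin d))) ⊆ K ∧
      Y.card ≤ n ∧
      ENNReal.ofReal (1 - ε) * volume K ≤ volume (convexHull ℝ (Y : Set (EuclideanSpace ℝ (Fin d))))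

/-- **Conic Carathéodory theorem**: a nonnegative combination of vectors can be rewritten as a
positive combination of linearly independent ones among them. -/
theorem exists_linearIndepOn_sum_smul_eq {ι E : Type*} [AddCommGroup E] [Module ℝ E]
    (x : ι → E) (s : Finset ι) (c : ι → ℝ) (hc : ∀ i ∈ s, 0 ≤ c i) :
    ∃ t ⊆ s, ∃ c' : ι → ℝ, (∀ i ∈ t, 0 < c' i) ∧ LinearIndepOn ℝ x (t : Set ι) ∧
      ∑ i ∈ t, c' i • x i = ∑ i ∈ s, c i • x i := by
  classical
  induction s using Finset.strongInduction generalizing c with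
  | H s ih =>
  by_cases hli : LinearIndepOn ℝ x (s : Set ι)
  · refine ⟨s.filter (fun i => 0 < c i), Finset.filter_subset _ _, c, by simp,
      hli.mono (Finset.coe_subset.2 (Finset.filter_subset _ _)), Finset.sum_filter_of_ne fun i hi hne => ?_⟩
    exact (hc i hi).lt_of_ne' fun h => hne (by rw [h, zero_smul])
  obtain ⟨g, hg, j, hj, hgj⟩ : ∃ g : ι → ℝ, ∑ i ∈ s, g i • x i = 0 ∧ ∃ j ∈ s, 0 < g j := by
    rw [linearIndepOn_finset_iff] at hli
    push Not at hli
    obtain ⟨g, hg, j, hj, hgj⟩ := hli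
    rcases lt_or_gt_of_ne hgj with h | h
    · exact ⟨fun i => -g i, by simp [hg], j, hj, by simpa using h⟩
    · exact ⟨g, hg, j, hj, h⟩
  obtain ⟨k, hk, hmin⟩ := (s.filter (fun i => 0 < g i)).exists_min_image (fun i => c i / g i)
    ⟨j, by simp [hj, hgj]⟩
  simp only [Finset.mem_filter] at hk hmin
  set r := c k / g k with hr
  have hr0 : 0 ≤ r := div_nonneg (hc k hk.1) hk.2.le
  obtain ⟨t, ht, c', hc', hli', hsum⟩ := ih (s.erase k) (Finset.erase_ssubset hk.1)
    (fun i => c i - r * g i) (by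
      intro i hi
      have his := Finset.mem_of_mem_erase hi
      rw [sub_nonneg]
      rcases le_or_gt (g i) 0 with h | h
      · exact (mul_nonpos_of_nonneg_of_nonpos hr0 h).trans (hc i his)
      · exact (le_div_iff₀ h).1 (hmin i ⟨his, h⟩))
  refine ⟨t, ht.trans (Finset.erase_subset _ _), c', hc', hli', hsum.trans ?_⟩
  rw [Finset.sum_erase]
  · simp only [sub_smul, mul_smul, Finset.sum_sub_distrib, ← Finset.smul_sum, hg]
    simp
  · rw [hr, div_mul_cancel₀ _ hk.2.ne', sub_self, zero_smul]

/-- A finitely generated convex cone in a finite-dimensional space is closed. -/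
theorem isClosed_setOf_sum_nonneg_smul {ι E : Type*} [Fintype ι] [NormedAddCommGroup E]
    [NormedSpace ℝ E] [FiniteDimensional ℝ E] (x : ι → E) :
    IsClosed {z : E | ∃ c : ι → ℝ, (∀ i, 0 ≤ c i) ∧ ∑ i, c i • x i = z} := by
  classical
  have key : {z : E | ∃ c : ι → ℝ, (∀ i, 0 ≤ c i) ∧ ∑ i, c i • x i = z} =
      ⋃ t ∈ {t : Finset ι | LinearIndepOn ℝ x (t : Set ι)},
        Fintype.linearCombination ℝ (fun i : t => x i) '' Set.Ici 0 := by
    ext z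
    simp only [Set.mem_ofPred_eq, Set.mem_iUnion, Set.mem_image, Set.mem_Ici, exists_prop,
      Fintype.linearCombination_apply]
    constructor
    · rintro ⟨c, hc, rfl⟩
      obtain ⟨t, -, c', hc', hli, hsum⟩ :=
        exists_linearIndepOn_sum_smul_eq x Finset.univ c (fun i _ => hc i)
      refine ⟨t, hli, fun i => c' i, fun i => (hc' i i.2).le, ?_⟩
      rw [← hsum, ← Finset.sum_coe_sort t]
    · rintro ⟨t, -, c, hc, rfl⟩
      refine ⟨fun i => if h : i ∈ t then c ⟨i, h⟩ else 0, fun i => ?_, ?_⟩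
      · dsimp only
        split_ifs with h
        · exact hc ⟨i, h⟩
        · exact le_rfl
      · rw [← Finset.sum_subset (Finset.subset_univ t) (fun i _ h => by simp [h]),
          ← Finset.sum_coe_sort t]
        exact Finset.sum_congr rfl fun i _ => by simp
  rw [key]
  refine Set.Finite.isClosed_biUnion (Set.toFinite _) fun t ht => ?_
  exact (LinearMap.isClosedEmbedding_of_injective (LinearMap.ker_eq_bot.2
    (linearIndependent_iff_injective_fintypeLinearCombination.1 ht))).isClosedMap _ isClosed_Ici

/-- If moving from `0` a short way in direction `w` does not get closer to `u`, then `w` makes no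
acute angle with `u`. -/
theorem inner_nonpos_of_norm_le_norm_sub_smul {E : Type*} [NormedAddCommGroup E]
    [InnerProductSpace ℝ E] {u w : E} {δ : ℝ} (hδ : 0 < δ)
    (h : ∀ t : ℝ, 0 < t → t ≤ δ → ‖u‖ ≤ ‖u - t • w‖) : inner ℝ u w ≤ 0 := by
  by_contra! hpos
  have hw : 0 < ‖w‖ ^ 2 + 1 := by positivity
  set t := min δ (inner ℝ u w / (‖w‖ ^ 2 + 1))
  have ht0 : 0 < t := lt_min hδ (div_pos hpos hw)
  have h1 : t * (‖w‖ ^ 2 + 1) ≤ inner ℝ u w := (le_div_iff₀ hw).1 (min_le_right _ _)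
  have h2 := pow_le_pow_left₀ (norm_nonneg _) (h t ht0 (min_le_left _ _)) 2
  rw [norm_sub_sq_real, inner_smul_right, norm_smul, Real.norm_of_nonneg ht0.le] at h2
  nlinarith [mul_pos ht0 hpos, mul_le_mul_of_nonneg_left h1 ht0.le]

open Module in
/-- **Colorful conic Carathéodory theorem**: given `dim E` finite color classes, such that every
open half-space through the origin containing `v` meets every class, `v` is a nonnegative
combination of a rainbow selection. -/
theorem exists_rainbow_sum_smul_eq {ι E : Type*} [Fintype ι] [NormedAddCommGroup E]
    [InnerProductSpace ℝ E] [FiniteDimensional ℝ E] (hι : finrank ℝ E ≤ Fintype.card ι)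
    (A : ι → Finset E) (hA : ∀ i, (A i).Nonempty) (v : E)
    (hv : ∀ i u, 0 < inner ℝ u v → ∃ a ∈ A i, 0 < inner ℝ u a) :
    ∃ x : ι → E, (∀ i, x i ∈ A i) ∧ ∃ c : ι → ℝ, (∀ i, 0 ≤ c i) ∧ ∑ i, c i • x i = v := by
  classical
  set T : Set E := ⋃ x ∈ (Fintype.piFinset A : Set (ι → E)),
    {z : E | ∃ c : ι → ℝ, (∀ i, 0 ≤ c i) ∧ ∑ i, c i • x i = z} with hT
  have memT : ∀ (x : ι → E) (c : ι → ℝ), (∀ i, x i ∈ A i) → (∀ i, 0 ≤ c i) →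
      ∑ i, c i • x i ∈ T := by
    intro x c hx hc
    exact Set.mem_biUnion (Finset.mem_coe.2 (Fintype.mem_piFinset.2 hx)) ⟨c, hc, rfl⟩
  have hTc : IsClosed T := Set.Finite.isClosed_biUnion (Finset.finite_toSet _)
    fun x _ => isClosed_setOf_sum_nonneg_smul x
  choose a ha using hA
  obtain ⟨z, hz, hdist⟩ := hTc.exists_infDist_eq_dist ⟨_, memT a 0 ha fun _ => le_rfl⟩ v
  have hmin : ∀ y ∈ T, ‖v - z‖ ≤ ‖v - y‖ := fun y hy => by
    rw [← dist_eq_norm, ← dist_eq_norm, ← hdist]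
    exact Metric.infDist_le_dist_of_mem hy
  simp only [hT, Set.mem_iUnion, Set.mem_ofPred_eq, exists_prop, Finset.mem_coe,
    Fintype.mem_piFinset] at hz
  obtain ⟨x, hx, c₀, hc₀, hsum₀⟩ := hz
  obtain ⟨s, hs, c, hc, hc_pos, hc_zero, hsum⟩ : ∃ s : Finset ι, LinearIndepOn ℝ x (s : Set ι) ∧
      ∃ c : ι → ℝ, (∀ i, 0 ≤ c i) ∧ (∀ i ∈ s, 0 < c i) ∧ (∀ i ∉ s, c i = 0) ∧
        ∑ i, c i • x i = z := by
    obtain ⟨s, -, c, hc, hli, hsum⟩ :=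
      exists_linearIndepOn_sum_smul_eq x Finset.univ c₀ (fun i _ => hc₀ i)
    refine ⟨s, hli, fun i => if i ∈ s then c i else 0, fun i => ?_, fun i hi => ?_,
      fun i hi => if_neg hi, ?_⟩
    · dsimp only
      split_ifs with h
      exacts [(hc i h).le, le_rfl]
    · simpa [hi] using hc i hi
    · simp [ite_smul, hsum, hsum₀]
  by_cases hu : v - z = 0
  · exact ⟨x, hx, c, hc, hsum.trans (sub_eq_zero.1 hu).symm⟩
  exfalso
  set u := v - z with hu_def
  have hstep : ∀ j b r, b ∈ A j → 0 ≤ c j + r → c j • b = c j • x j → ‖u‖ ≤ ‖u - r • b‖ := by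
    intro j b r hb hr hcb
    have hmem := memT (Function.update x j b) (Function.update c j (c j + r))
      (fun i => by by_cases h : i = j <;> [(subst h; simpa using hb); simpa [h] using hx i])
      (fun i => by by_cases h : i = j <;> [(subst h; simpa using hr); simpa [h] using hc i])
    have heq : ∑ i, Function.update c j (c j + r) i • Function.update x j b i = z + r • b := by
      rw [← hsum, ← Finset.add_sum_erase _ _ (Finset.mem_univ j),
        ← Finset.add_sum_erase _ _ (Finset.mem_univ j), Finset.sum_congr rfl
          (g := fun i => c i • x i) fun i hi => by simp [Finset.ne_of_mem_erase hi]]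
      simp only [Function.update_self, add_smul, hcb]
      abel
    rw [heq] at hmem
    simpa only [hu_def, sub_sub] using hmin _ hmem
  have horth : ∀ i ∈ s, inner ℝ u (x i) = 0 := by
    intro i hi
    refine le_antisymm (inner_nonpos_of_norm_le_norm_sub_smul (hc_pos i hi) fun t ht _ =>
      hstep i (x i) t (hx i) (add_nonneg (hc i) ht.le) rfl) ?_
    rw [← neg_nonpos, ← inner_neg_right]
    refine inner_nonpos_of_norm_le_norm_sub_smul (hc_pos i hi) fun t _ ht => ?_
    simpa using hstep i (x i) (-t) (hx i) (by linarith) rfl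
  have hz0 : inner ℝ u z = 0 := by
    rw [← hsum, inner_sum]
    refine Finset.sum_eq_zero fun i _ => ?_
    by_cases hi : i ∈ s
    · rw [inner_smul_right, horth i hi, mul_zero]
    · rw [hc_zero i hi, zero_smul, inner_zero_right]
  obtain ⟨j, hj⟩ : ∃ j, j ∉ s := by
    by_contra! hall
    have hli : LinearIndependent ℝ x := by
      rw [← linearIndepOn_univ_iff]
      exact hs.mono fun i _ => hall i
    have hspan := hli.span_eq_top_of_card_eq_finrank' (hli.fintype_card_le_finrank.antisymm hι)
    have hle : Submodule.span ℝ (Set.range x) ≤ (ℝ ∙ u)ᗮ := by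
      rw [Submodule.span_le]
      rintro _ ⟨i, rfl⟩
      exact Submodule.mem_orthogonal_singleton_iff_inner_right.2 (horth i (hall i))
    have hmem : u ∈ (ℝ ∙ u)ᗮ := hle (hspan ▸ Submodule.mem_top)
    exact hu (inner_self_eq_zero (𝕜 := ℝ).1 (Submodule.mem_orthogonal_singleton_iff_inner_right.1 hmem))
  obtain ⟨b, hb, hpos⟩ := hv j u (by
    have : inner ℝ u v = inner ℝ u u := by
      rw [show v = u + z by simp [hu_def], inner_add_right, hz0, add_zero]
    rw [this]
    exact real_inner_self_pos.2 hu)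
  exact hpos.not_ge (inner_nonpos_of_norm_le_norm_sub_smul one_pos fun t ht _ =>
    hstep j b t hb (by rw [hc_zero j hj, zero_add]; exact ht.le) (by simp [hc_zero j hj]))

open Module in
/-- **Colorful Carathéodory theorem with a prescribed vertex**: if `p` lies in the convex hull of
each of `dim E` color classes, then for every `q` it lies in the convex hull of `q` and a rainbow
selection. -/
theorem exists_rainbow_mem_convexHull_insert {ι E : Type*} [Fintype ι] [NormedAddCommGroup E]
    [InnerProductSpace ℝ E] [FiniteDimensional ℝ E] (hι : finrank ℝ E ≤ Fintype.card ι)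
    (X : ι → Set E) (p q : E) (hp : ∀ i, p ∈ convexHull ℝ (X i)) :
    ∃ x : ι → E, (∀ i, x i ∈ X i) ∧ p ∈ convexHull ℝ (insert q (Set.range x)) := by
  classical
  have hfin : ∀ i, ∃ A : Finset E, (A : Set E) ⊆ X i ∧ p ∈ convexHull ℝ (A : Set E) := by
    intro i
    have h := hp i
    rw [convexHull_eq_union_convexHull_finite_subsets] at h
    simpa using h
  choose A hAX hpA using hfin
  set F : Set E := ⋃ x ∈ (Fintype.piFinset A : Set (ι → E)),
    convexHull ℝ (insert q (Set.range x)) with hF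
  have hFc : IsClosed F := Set.Finite.isClosed_biUnion (Finset.finite_toSet _)
    fun x _ => ((Set.finite_range x).insert q).isClosed_convexHull ℝ
  suffices h : p ∈ F by
    simp only [hF, Set.mem_iUnion, exists_prop, Finset.mem_coe, Fintype.mem_piFinset] at h
    obtain ⟨x, hx, hpx⟩ := h
    exact ⟨x, fun i => hAX i (hx i), hpx⟩
  have hIoo : ∀ t ∈ Set.Ioo (0 : ℝ) 1, AffineMap.lineMap q p t ∈ F := by
    rintro t ⟨ht0, ht1⟩
    set y : E := AffineMap.lineMap q p t with hy
    have hyq : y - q = t • (p - q) := by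
      rw [hy, AffineMap.lineMap_apply_module']
      abel
    have hpy : p - y = (1 - t) • (p - q) := by
      rw [hy, AffineMap.lineMap_apply_module']
      module
    obtain ⟨w, hw, c, hc, hsum⟩ := exists_rainbow_sum_smul_eq hι
      (fun i => (A i).image (· - y))
      (fun i => (Finset.coe_nonempty.1 (convexHull_nonempty_iff.1 ⟨p, hpA i⟩)).image _) (y - q) (by
        intro i u hu
        by_contra! hneg
        simp only [Finset.forall_mem_image] at hneg
        have hsub : convexHull ℝ (A i : Set E) ⊆ {e | inner ℝ u e ≤ inner ℝ u y} := by
          refine convexHull_min (fun e he => ?_)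
            (convex_halfSpace_le (innerₗ E u).isLinear _)
          have := hneg he
          rw [inner_sub_right] at this
          exact sub_nonpos.1 this
        have h1 : inner ℝ u (p - y) ≤ 0 := by
          rw [inner_sub_right]
          exact sub_nonpos.2 (hsub (hpA i))
        rw [hpy, inner_smul_right] at h1
        rw [hyq, inner_smul_right] at hu
        have := pos_of_mul_pos_right hu ht0.le
        nlinarith)
    simp only [Finset.mem_image] at hw
    choose x hxA hxw using hw
    refine Set.mem_biUnion (Finset.mem_coe.2 (Fintype.mem_piFinset.2 hxA)) ?_
    have hC : 0 ≤ ∑ i, c i := Finset.sum_nonneg fun i _ => hc i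
    have hy_eq : (1 + ∑ i, c i) • y = q + ∑ i, c i • x i := by
      simp only [← hxw, smul_sub, Finset.sum_sub_distrib, ← Finset.sum_smul] at hsum
      rw [add_smul, one_smul, ← sub_eq_zero]
      rw [← sub_eq_zero] at hsum
      rw [← neg_eq_zero, ← hsum]
      abel
    have hC' : 0 < 1 + ∑ i, c i := by linarith
    have hmem := (convex_convexHull ℝ (insert q (Set.range x))).sum_mem
      (t := Finset.univ) (w := fun o : Option ι => o.elim 1 c / (1 + ∑ i, c i))
      (z := fun o => o.elim q x) ?_ ?_ ?_
    · convert hmem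
      rw [← inv_smul_smul₀ hC'.ne' y, hy_eq]
      simp [Fintype.sum_option, div_eq_inv_mul, mul_smul, Finset.smul_sum]
    · rintro (_ | i) -
      · simp only [Option.elim]; positivity
      · have := hc i
        simp only [Option.elim]; positivity
    · rw [← Finset.sum_div, Fintype.sum_option]
      exact div_self hC'.ne'
    · rintro (_ | i) -
      · exact subset_convexHull ℝ _ (Set.mem_insert _ _)
      · exact subset_convexHull ℝ _ (Set.mem_insert_of_mem _ ⟨i, rfl⟩)
  have hmaps : closure (AffineMap.lineMap q p '' Set.Ioo (0 : ℝ) 1) ⊆ closure F :=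
    closure_mono (Set.image_subset_iff.2 hIoo)
  rw [hFc.closure_eq] at hmaps
  refine hmaps ?_
  have hcont : Continuous (AffineMap.lineMap q p : ℝ → E) := AffineMap.lineMap_continuous
  have h1 : (1 : ℝ) ∈ closure (Set.Ioo (0 : ℝ) 1) := by
    rw [closure_Ioo zero_ne_one]
    simp
  simpa using image_closure_subset_closure_image hcont ⟨1, h1, rfl⟩

/-- If every vertex of a full-dimensional polytope `conv Y` is in the convex hull of a nonempty
closed convex set `C` and an interior point `q` of `conv Y`, then `conv Y ⊆ C`. -/
theorem convexHull_subset_of_subset_convexHull_insert {E : Type*} [NormedAddCommGroup E]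
    [NormedSpace ℝ E] {Y C : Set E} {q : E} (hC : Convex ℝ C) (hCc : IsClosed C)
    (hCne : C.Nonempty) (hq : q ∈ interior (convexHull ℝ Y))
    (hY : Y ⊆ convexHull ℝ (insert q C)) : convexHull ℝ Y ⊆ C := by
  have hqC : q ∈ C := by
    by_contra hqC
    obtain ⟨f, a, hfq, hfa⟩ := geometric_hahn_banach_point_closed hC hCc hqC
    have hsub : convexHull ℝ Y ⊆ {e | f q ≤ f e} := by
      have hconv : Convex ℝ {e | f q ≤ f e} := convex_halfSpace_ge f.toLinearMap.isLinear _
      refine convexHull_min (hY.trans (convexHull_min ?_ hconv)) hconv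
      exact Set.insert_subset (Set.mem_ofPred.2 le_rfl) fun e he => (hfq.trans (hfa e he)).le
    have hmin : IsLocalMin f q := by
      filter_upwards [mem_interior_iff_mem_nhds.1 hq] with e he using hsub he
    have hf0 := hmin.hasFDerivAt_eq_zero f.hasFDerivAt
    obtain ⟨e, he⟩ := hCne
    have := hfq.trans (hfa e he)
    simp [hf0] at this
  rw [Set.insert_eq_of_mem hqC, hC.convexHull_eq] at hY
  exact convexHull_min hY hC

/-- The convex hull of a set of nonzero volume in a finite-dimensional space has an interior
point. -/
theorem interior_convexHull_nonempty_of_measure_ne_zero {E : Type*} [NormedAddCommGroup E]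
    [NormedSpace ℝ E] [MeasurableSpace E] [BorelSpace E] [FiniteDimensional ℝ E]
    (μ : Measure E) [μ.IsAddHaarMeasure] {s : Set E} (hs : μ (convexHull ℝ s) ≠ 0) :
    (interior (convexHull ℝ s)).Nonempty := by
  rw [interior_convexHull_nonempty_iff_affineSpan_eq_top]
  by_contra h
  exact hs (measure_mono_null (convexHull_subset_affineSpan s)
    (Measure.addHaar_affineSubspace μ _ h))

/-- Colorful quantitative Steinitz theorem with volume (Theorem 2.4). -/
theorem colorful_quantitative_steinitz_volume
    (d n : ℕ) (hd : 0 < d) (hn : 0 < n) (ε : ℝ) (hε : ε ∈ Set.Ioo (0 : ℝ) 1)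
    (hprop : InscribedPolytopeProp d n ε)
    (X : Fin (d * n) → Set (EuclideanSpace ℝ (Fin d)))
    (K : Set (EuclideanSpace ℝ (Fin d)))
    (hKcpt : IsCompact K) (hKconv : Convex ℝ K) (hKvol : volume K = 1)
    (hKX : ∀ i, K ⊆ convexHull ℝ (X i)) :
    ∃ x : Fin (d * n) → EuclideanSpace ℝ (Fin d),
      (∀ i, x i ∈ X i) ∧
      ENNReal.ofReal (1 - ε) ≤ volume (convexHull ℝ (Set.range x)) := by
  obtain ⟨Y, hYK, hYcard, hYvol⟩ := hprop K hKcpt hKconv (by simp [hKvol])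
  rw [hKvol, mul_one] at hYvol
  have hpos : 0 < volume (convexHull ℝ (Y : Set (EuclideanSpace ℝ (Fin d)))) :=
    (ENNReal.ofReal_pos.2 (sub_pos.2 hε.2)).trans_le hYvol
  obtain ⟨q, hq⟩ := interior_convexHull_nonempty_of_measure_ne_zero volume hpos.ne'
  obtain ⟨y₀, hy₀⟩ := convexHull_nonempty_iff.1 ⟨q, interior_subset hq⟩
  have : Nonempty Y := ⟨⟨y₀, hy₀⟩⟩
  obtain ⟨g⟩ : Nonempty (Y ↪ Fin n) :=
    Function.Embedding.nonempty_of_card_le (by simpa using hYcard)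
  have hrainbow : ∀ k : Fin n, ∃ x : Fin d → EuclideanSpace ℝ (Fin d),
      (∀ i, x i ∈ X (finProdFinEquiv (i, k))) ∧
        ((Function.invFun g k : Y) : EuclideanSpace ℝ (Fin d)) ∈
          convexHull ℝ (insert q (Set.range x)) := fun k =>
    exists_rainbow_mem_convexHull_insert (ι := Fin d) (by simp) (fun i => X (finProdFinEquiv (i, k))) _ q
      fun i => hKX _ (hYK (Function.invFun g k).2)
  choose x hxX hxY using hrainbow
  set x' : Fin (d * n) → EuclideanSpace ℝ (Fin d) := fun m =>
    x (finProdFinEquiv.symm m).2 (finProdFinEquiv.symm m).1 with hx'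
  refine ⟨x', fun m => ?_, hYvol.trans (measure_mono ?_)⟩
  · simpa [-finProdFinEquiv_symm_apply] using
      hxX (finProdFinEquiv.symm m).2 (finProdFinEquiv.symm m).1
  · refine convexHull_subset_of_subset_convexHull_insert (convex_convexHull ℝ _)
      ((Set.finite_range x').isClosed_convexHull ℝ)
      (convexHull_nonempty_iff.2 ⟨_, ⟨⟨0, Nat.mul_pos hd hn⟩, rfl⟩⟩) hq fun y hy => ?_
    have hmem := hxY (g ⟨y, hy⟩)
    rw [Function.leftInverse_invFun g.injective] at hmem
    refine convexHull_mono (Set.insert_subset_insert ?_) hmem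
    rintro _ ⟨i, rfl⟩
    exact subset_convexHull ℝ _ ⟨finProdFinEquiv (i, g ⟨y, hy⟩), by
      simp [hx', -finProdFinEquiv_symm_apply]⟩
end

section
/- Let d be a positive integer, let ε > 0, and let n be a positive integer with the ball-approximation property for (d, ε). If X_1, X_2, …, X_{(n−1)d+1} are sets in ℝ^d such that B_1(0) ⊆ conv(X_i) for every i = 1, …, (n−1)d+1, then one can choose points x_1 ∈ X_1, x_2 ∈ X_2, …, x_{(n−1)d+1} ∈ X_{(n−1)d+1} such that B_{1/(1+ε)}(0) ⊆ conv{x_1, x_2, …, x_{(n−1)d+1}}. -/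
open Pointwise

/-- A positive integer `n` has the ball-approximation property for `(d, ε)` if there is a
finite set `V ⊆ B_1(0)` with `|V| ≤ n` such that `B_1(0) ⊆ (1 + ε)·conv(V)`. -/
def BallApproxProp (d n : ℕ) (ε : ℝ) : Prop :=
  ∃ V : Finset (EuclideanSpace ℝ (Fin d)),
    (V : Set (EuclideanSpace ℝ (Fin d))) ⊆ Metric.closedBall 0 1 ∧ V.card ≤ n ∧
    Metric.closedBall (0 : EuclideanSpace ℝ (Fin d)) 1 ⊆
      (1 + ε) • convexHull ℝ (V : Set (EuclideanSpace ℝ (Fin d)))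

section ColorfulCaratheodory

open scoped RealInnerProductSpace

variable {E : Type*} [NormedAddCommGroup E] [InnerProductSpace ℝ E]

/-- If moving from `z` a little in the direction `y` does not decrease the distance to `a`,
then `y` makes a non-acute angle with `a - z`. -/
lemma inner_sub_nonpos_of_dist_le {a z y : E} {δ : ℝ} (hδ : 0 < δ)
    (h : ∀ s, 0 < s → s < δ → dist a z ≤ dist a (z + s • y)) : ⟪a - z, y⟫ ≤ 0 := by
  by_contra! hpos
  have hy : 0 < ‖y‖ ^ 2 := by
    have : y ≠ 0 := by rintro rfl; simp at hpos
    positivity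
  obtain ⟨s, hs0, hs⟩ := exists_between (lt_min hδ (div_pos hpos hy))
  have hs1 := (lt_min_iff.1 hs).1
  have hs2 := (lt_div_iff₀ hy).1 (lt_min_iff.1 hs).2
  have key := h s hs0 hs1
  rw [dist_eq_norm, dist_eq_norm, ← sub_sub] at key
  have key2 := pow_le_pow_left₀ (norm_nonneg _) key 2
  rw [norm_sub_sq_real (a - z), inner_smul_right, norm_smul, mul_pow, Real.norm_eq_abs,
    sq_abs] at key2
  nlinarith

/-- The cone spanned by a finite linearly independent family is closed. -/
lemma LinearIndependent.isClosed_cone {ι : Type*} [Fintype ι] {x : ι → E}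
    (hx : LinearIndependent ℝ x) :
    IsClosed ((fun c : ι → ℝ => ∑ i, c i • x i) '' {c | 0 ≤ c}) := by
  have hinj : LinearMap.ker (Fintype.linearCombination ℝ x) = ⊥ :=
    LinearMap.ker_eq_bot.2 hx.fintypeLinearCombination_injective
  have hemb := LinearMap.isClosedEmbedding_of_injective hinj
  exact hemb.isClosedMap _ isClosed_Ici

/-- The union of the simplicial cones spanned by linearly independent parts of colorful choices
from the family `F`. -/
def colorfulCones {ι : Type*} [Fintype ι] (F : ι → Finset E) : Set E :=
  {z | ∃ x : ι → E, (∀ i, x i ∈ F i) ∧ ∃ c : ι → ℝ, (∀ i, 0 ≤ c i) ∧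
    LinearIndepOn ℝ x {i | c i ≠ 0} ∧ ∑ i, c i • x i = z}

lemma isClosed_colorfulCones {ι : Type*} [Fintype ι] (F : ι → Finset E) :
    IsClosed (colorfulCones F) := by
  classical
  have hfin : {x : ι → E | ∀ i, x i ∈ F i}.Finite := by
    simpa [Set.pi] using Set.Finite.pi' fun i => (F i).finite_toSet
  have heq : colorfulCones F = ⋃ p ∈ ({x : ι → E | ∀ i, x i ∈ F i} ×ˢ (Set.univ : Set (Set ι))) ∩
      {p | LinearIndepOn ℝ p.1 p.2},
      (fun c : p.2 → ℝ => ∑ i, c i • p.1 i) '' {c | 0 ≤ c} := by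
    ext z
    simp only [Set.mem_iUnion, exists_prop, Prod.exists]
    constructor
    · rintro ⟨x, hx, c, hc, hli, rfl⟩
      obtain ⟨S, hS⟩ : ∃ S, S = {i | c i ≠ 0} := ⟨_, rfl⟩
      rw [← hS] at hli
      refine ⟨x, S, ⟨⟨hx, trivial⟩, hli⟩, fun i => c i, fun i => hc i, ?_⟩
      refine Fintype.sum_of_injective _ Subtype.val_injective _ _ (fun i hi => ?_) fun _ => rfl
      have : c i = 0 := by simpa [hS] using hi
      rw [this, zero_smul]
    · rintro ⟨x, S, ⟨⟨hx, -⟩, hli⟩, c, hc, rfl⟩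
      refine ⟨x, hx, fun i => if h : i ∈ S then c ⟨i, h⟩ else 0, ?_, ?_, ?_⟩
      · intro i
        dsimp only
        split_ifs
        exacts [hc _, le_rfl]
      · refine hli.mono fun i hi => ?_
        by_contra h
        simp [h] at hi
      · refine (Fintype.sum_of_injective _ Subtype.val_injective _ _ (fun i hi => ?_)
          fun i => ?_).symm
        · have : i ∉ S := by simpa using hi
          simp [this]
        · simp
  rw [heq]
  refine Set.Finite.isClosed_biUnion ((hfin.prod Set.finite_univ).inter_of_left _) ?_
  rintro ⟨x, S⟩ ⟨-, hli⟩
  exact LinearIndependent.isClosed_cone hli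

/-- **Colorful Carathéodory theorem for cones**. The hypothesis `hF` says that `a` lies in the
cone spanned by each `F i`. -/
theorem colorful_caratheodory_cone [FiniteDimensional ℝ E] {ι : Type*} [Fintype ι]
    (hι : Fintype.card ι = Module.finrank ℝ E) (F : ι → Finset E) (hne : ∀ i, (F i).Nonempty)
    (a : E) (hF : ∀ i w, 0 < ⟪w, a⟫ → ∃ y ∈ F i, 0 < ⟪w, y⟫) :
    ∃ x : ι → E, (∀ i, x i ∈ F i) ∧ ∃ c : ι → ℝ, (∀ i, 0 ≤ c i) ∧ ∑ i, c i • x i = a := by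
  classical
  have hU : (colorfulCones F).Nonempty := by
    choose x hx using hne
    exact ⟨_, x, hx, 0, by simp, by simp, rfl⟩
  obtain ⟨z, hz, hmin⟩ := (isClosed_colorfulCones F).exists_infDist_eq_dist hU a
  have hle : ∀ y ∈ colorfulCones F, dist a z ≤ dist a y := fun y hy =>
    hmin ▸ Metric.infDist_le_dist_of_mem hy
  obtain ⟨x, hx, c, hc, hli, rfl⟩ := hz
  refine ⟨x, hx, c, hc, ?_⟩
  set z := ∑ i, c i • x i with hzdef
  by_contra hza
  have hw : a - z ≠ 0 := fun h => hza (sub_eq_zero.1 h).symm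
  have horth : ∀ i, c i ≠ 0 → ⟪a - z, x i⟫ = 0 := by
    intro i hi
    have hci : 0 < c i := lt_of_le_of_ne (hc i) hi.symm
    have hmem : ∀ r : ℝ, -c i < r → z + r • x i ∈ colorfulCones F := by
      intro r hr
      refine ⟨x, hx, c + Pi.single i r, ?_, hli.mono ?_, ?_⟩
      · intro j
        rcases eq_or_ne j i with rfl | hj
        · simp; linarith
        · simpa [hj] using hc j
      · intro j hj
        rcases eq_or_ne j i with rfl | hji
        · exact hi
        · simpa [hji] using hj
      · simp [add_smul, Finset.sum_add_distrib, Pi.single_apply, ite_smul, hzdef]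
    apply le_antisymm
    · exact inner_sub_nonpos_of_dist_le one_pos fun s hs _ => hle _ (hmem s (by linarith))
    · have := inner_sub_nonpos_of_dist_le (a := a) (z := z) (y := -x i) hci fun s hs hs' => by
        have := hle _ (hmem (-s) (by linarith))
        simpa using this
      simpa using this
  have hzorth : ⟪a - z, z⟫ = 0 := by
    rw [hzdef, inner_sum]
    refine Finset.sum_eq_zero fun i _ => ?_
    rw [inner_smul_right]
    by_cases hi : c i = 0
    · simp [hi]
    · rw [← hzdef, horth i hi, mul_zero]
  have hapos : 0 < ⟪a - z, a⟫ := by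
    have h1 : ⟪a - z, a - z⟫ = ⟪a - z, a⟫ - ⟪a - z, z⟫ := inner_sub_right _ _ _
    rw [hzorth, sub_zero] at h1
    rw [← h1]
    exact real_inner_self_pos.2 hw
  by_cases hall : ∀ i, c i ≠ 0
  · have hli' : LinearIndependent ℝ x := by
      have : {i | c i ≠ 0} = Set.univ := Set.eq_univ_of_forall hall
      rwa [this, linearIndepOn_univ_iff] at hli
    have htop := hli'.span_eq_top_of_card_eq_finrank' hι
    have ha : a ∈ Submodule.span ℝ (Set.range x) := htop ▸ Submodule.mem_top
    have hspan : Submodule.span ℝ (Set.range x) ≤ LinearMap.ker (innerₛₗ ℝ (a - z)) := by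
      rw [Submodule.span_le]
      rintro _ ⟨i, rfl⟩
      exact horth i (hall i)
    have := hspan ha
    rw [LinearMap.mem_ker, innerₛₗ_apply_apply] at this
    exact hapos.ne' this
  · push Not at hall
    obtain ⟨i, hi⟩ := hall
    obtain ⟨y, hy, hypos⟩ := hF i (a - z) hapos
    refine hypos.not_ge (inner_sub_nonpos_of_dist_le one_pos fun s hs _ => hle _ ?_)
    have hagree : ∀ j, c j ≠ 0 → Function.update x i y j = x j := by
      intro j hj
      rw [Function.update_of_ne]
      rintro rfl
      exact hj hi
    refine ⟨Function.update x i y, ?_, Function.update c i s, ?_, ?_, ?_⟩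
    · intro j
      rcases eq_or_ne j i with rfl | hj
      · simpa
      · simpa [hj] using hx j
    · intro j
      rcases eq_or_ne j i with rfl | hj
      · simpa using hs.le
      · simpa [hj] using hc j
    · have hli2 : LinearIndepOn ℝ (Function.update x i y) {j | c j ≠ 0} :=
        hli.congr fun j hj => (hagree j hj).symm
      have hins : LinearIndepOn ℝ (Function.update x i y) (insert i {j | c j ≠ 0}) := by
        refine hli2.insert fun hmem => ?_
        have hspan : Submodule.span ℝ (Function.update x i y '' {j | c j ≠ 0}) ≤
            LinearMap.ker (innerₛₗ ℝ (a - z)) := by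
          rw [Submodule.span_le]
          rintro _ ⟨j, hj, rfl⟩
          rw [hagree j hj]
          exact horth j hj
        have := hspan hmem
        rw [LinearMap.mem_ker, innerₛₗ_apply_apply, Function.update_self] at this
        exact hypos.ne' this
      refine hins.mono fun j hj => ?_
      rcases eq_or_ne j i with rfl | hji
      · exact Set.mem_insert _ _
      · exact Or.inr (by simpa [hji] using hj)
    · rw [hzdef, ← Finset.add_sum_erase _ _ (Finset.mem_univ i),
        ← Finset.add_sum_erase _ (fun j => c j • x j) (Finset.mem_univ i), hi]
      simp only [Function.update_self, zero_smul, zero_add]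
      rw [add_comm]
      congr 1
      refine Finset.sum_congr rfl fun j hj => ?_
      rw [Function.update_of_ne (Finset.ne_of_mem_erase hj),
        Function.update_of_ne (Finset.ne_of_mem_erase hj)]

lemma exists_inner_le_of_mem_convexHull {s : Set E} {v : E} (hv : v ∈ convexHull ℝ s) (w : E) :
    ∃ y ∈ s, ⟪w, v⟫ ≤ ⟪w, y⟫ := by
  by_contra! h
  have hconv : Convex ℝ {y : E | innerₛₗ ℝ w y < ⟪w, v⟫} :=
    convex_halfSpace_lt (innerₛₗ ℝ w).isLinear _
  have hlt : v ∈ {y : E | innerₛₗ ℝ w y < ⟪w, v⟫} :=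
    convexHull_min (fun y hy => h y hy) hconv hv
  exact lt_irrefl ⟪w, v⟫ hlt

/-- A colorful Carathéodory theorem with one point (here the origin) prescribed. -/
theorem colorful_caratheodory_insert_zero [FiniteDimensional ℝ E] {ι : Type*} [Fintype ι]
    (hι : Fintype.card ι = Module.finrank ℝ E) (X : ι → Set E) (v : E)
    (hv : ∀ i, v ∈ convexHull ℝ (X i)) :
    ∃ x : ι → E, (∀ i, x i ∈ X i) ∧ v ∈ convexHull ℝ (insert 0 (Set.range x)) := by
  classical
  have hfinite : ∀ i, ∃ F : Finset E, (F : Set E) ⊆ X i ∧ v ∈ convexHull ℝ (F : Set E) := by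
    intro i
    have := hv i
    rw [convexHull_eq_union_convexHull_finite_subsets] at this
    simpa using this
  choose F hFX hFv using hfinite
  have hfin : {x : ι → E | ∀ i, x i ∈ F i}.Finite := by
    simpa [Set.pi] using Set.Finite.pi' fun i => (F i).finite_toSet
  set K : Set E := ⋃ x ∈ {x : ι → E | ∀ i, x i ∈ F i}, convexHull ℝ (insert 0 (Set.range x))
    with hK
  have hclosed : IsClosed K := hfin.isClosed_biUnion fun x _ =>
    ((Set.finite_range x).insert 0).isClosed_convexHull ℝ
  have hscaled : ∀ t : ℝ, 0 ≤ t → t < 1 → t • v ∈ K := by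
    intro t ht0 ht1
    obtain ⟨u, hu, c, hc, hsum⟩ := colorful_caratheodory_cone hι
      (fun i => (F i).image (· - t • v))
      (fun i => (Finset.coe_nonempty.1 (convexHull_nonempty_iff.1 ⟨v, hFv i⟩)).image _) (t • v) (by
        intro i w hw
        obtain ⟨y, hy, hle⟩ := exists_inner_le_of_mem_convexHull (hFv i) w
        refine ⟨y - t • v, Finset.mem_image_of_mem _ hy, ?_⟩
        rw [inner_smul_right] at hw
        rw [inner_sub_right, inner_smul_right]
        have : 0 < ⟪w, v⟫ := by
          by_contra! h
          exact hw.not_ge (mul_nonpos_of_nonneg_of_nonpos ht0 h)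
        nlinarith)
    have hmem : ∀ i, ∃ y ∈ F i, y - t • v = u i := fun i => by simpa using hu i
    choose x hx hxu using hmem
    refine Set.mem_biUnion (show x ∈ {x : ι → E | ∀ i, x i ∈ F i} from hx) ?_
    set C := ∑ i, c i
    have hC : 0 ≤ C := Finset.sum_nonneg fun i _ => hc i
    have hC1 : 0 < 1 + C := by linarith
    have hcomb : t • v = (1 / (1 + C)) • (0 : E) + ∑ i, (c i / (1 + C)) • x i := by
      have h1 : (1 + C) • (t • v) = ∑ i, c i • x i := by
        simp only [← hxu, smul_sub, Finset.sum_sub_distrib, ← Finset.sum_smul] at hsum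
        rw [add_smul, one_smul]
        nth_rewrite 1 [← hsum]
        abel
      have h2 : ∑ i, (c i / (1 + C)) • x i = (1 + C)⁻¹ • ∑ i, c i • x i := by
        rw [Finset.smul_sum]
        exact Finset.sum_congr rfl fun i _ => by rw [smul_smul, div_eq_inv_mul]
      rw [smul_zero, zero_add, h2, ← h1, smul_smul, inv_mul_cancel₀ hC1.ne', one_smul]
    rw [hcomb]
    have := (convex_convexHull ℝ (insert 0 (Set.range x))).sum_mem (t := Finset.univ)
      (w := fun o : Option ι => o.elim (1 / (1 + C)) fun i => c i / (1 + C))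
      (z := fun o : Option ι => o.elim 0 x) ?_ ?_ ?_
    · simpa [Fintype.sum_option] using this
    · rintro (_ | i) -
      · simp only [Option.elim]; positivity
      · exact div_nonneg (hc i) hC1.le
    · simp only [Fintype.sum_option, Option.elim]
      rw [← Finset.sum_div, ← add_div, div_self hC1.ne']
    · rintro (_ | i) -
      · exact subset_convexHull ℝ _ (Set.mem_insert _ _)
      · exact subset_convexHull ℝ _ (Set.mem_insert_of_mem _ ⟨i, rfl⟩)
  have hvK : v ∈ K := by
    have hlim : Filter.Tendsto (fun t : ℝ => t • v) (nhdsWithin 1 (Set.Iio 1)) (nhds v) := by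
      have : ContinuousAt (fun t : ℝ => t • v) 1 := by fun_prop
      simpa [ContinuousAt] using this.tendsto.mono_left nhdsWithin_le_nhds
    refine hclosed.mem_of_tendsto hlim ?_
    filter_upwards [Ioo_mem_nhdsLT (show (0 : ℝ) < 1 from one_pos)] with t ht
    exact hscaled t ht.1.le ht.2
  rw [hK] at hvK
  simp only [Set.mem_iUnion, exists_prop] at hvK
  obtain ⟨x, hx, hxv⟩ := hvK
  exact ⟨x, fun i => hFX i (hx i), hxv⟩

/-- If adding the origin to a finite set makes its convex hull contain a ball around the origin,
then the origin was already in the convex hull. -/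
lemma convexHull_insert_zero_of_closedBall_subset {s : Set E} (hs : s.Finite)
    (hne : s.Nonempty) {r : ℝ} (hr : 0 < r)
    (h : Metric.closedBall 0 r ⊆ convexHull ℝ (insert 0 s)) :
    convexHull ℝ (insert 0 s) = convexHull ℝ s := by
  have h0 : (0 : E) ∈ convexHull ℝ s := by
    by_contra h0
    obtain ⟨f, u, hu, hf⟩ := geometric_hahn_banach_point_closed (convex_convexHull ℝ s)
      (hs.isClosed_convexHull ℝ) h0
    rw [map_zero] at hu
    have hpos : ∀ y ∈ s, 0 < f y := fun y hy => hu.trans (hf y (subset_convexHull ℝ s hy))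
    have hsub : convexHull ℝ (insert 0 s) ⊆ {y | 0 ≤ f y} := by
      refine convexHull_min ?_ (convex_halfSpace_ge f.toLinearMap.isLinear 0)
      rintro y (rfl | hy)
      · simp
      · exact (hpos y hy).le
    obtain ⟨y, hy⟩ := hne
    have hy0 : 0 < ‖y‖ := norm_pos_iff.2 fun h => by simpa [h] using hpos y hy
    have hmem : -(r / ‖y‖) • y ∈ Metric.closedBall (0 : E) r := by
      rw [mem_closedBall_zero_iff, norm_smul, norm_neg, Real.norm_of_nonneg (by positivity),
        div_mul_cancel₀ _ hy0.ne']
    have := hsub (h hmem)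
    simp only [Set.mem_ofPred_eq, map_smul, smul_eq_mul] at this
    have := mul_pos (div_pos hr hy0) (hpos y hy)
    linarith
  refine (convexHull_min ?_ (convex_convexHull ℝ s)).antisymm
    (convexHull_mono (Set.subset_insert _ _))
  exact Set.insert_subset h0 (subset_convexHull ℝ s)

end ColorfulCaratheodory

/-- Two vectors of the same norm are related by a linear isometry. -/
lemma exists_linearIsometryEquiv_apply_eq {E : Type*} [NormedAddCommGroup E]
    [InnerProductSpace ℝ E] {v w : E} (h : ‖v‖ = ‖w‖) :
    ∃ R : E ≃ₗᵢ[ℝ] E, R v = w :=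
  ⟨_, Submodule.reflection_sub h⟩

/-- The ball-approximation property allows prescribing the direction of one of the points. -/
lemma BallApproxProp.exists_fin {d n : ℕ} {ε : ℝ} (hε : 0 < ε) (h : BallApproxProp d n ε)
    {x₀ : EuclideanSpace ℝ (Fin d)} (hx₀ : 1 ≤ ‖x₀‖) :
    ∃ p : Fin (n - 1) → EuclideanSpace ℝ (Fin d), (∀ j, p j ∈ Metric.closedBall 0 1) ∧
      ∃ q ∈ segment ℝ 0 x₀, Metric.closedBall 0 (1 / (1 + ε)) ⊆
        convexHull ℝ (insert q (insert 0 (Set.range p))) := by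
  classical
  obtain ⟨V, hV1, hVn, hV⟩ := h
  have hε1 : 0 < 1 + ε := by linarith
  have hne : V.Nonempty := by
    by_contra hne
    rw [Finset.not_nonempty_iff_eq_empty] at hne
    simpa [hne] using hV (Metric.mem_closedBall_self zero_le_one)
  obtain ⟨v₀, hv₀⟩ := hne
  have hx₀pos : 0 < ‖x₀‖ := by linarith
  have hv₀1 : ‖v₀‖ ≤ 1 := by simpa using hV1 hv₀
  obtain ⟨R, hR⟩ := exists_linearIsometryEquiv_apply_eq (v := v₀) (w := (‖v₀‖ / ‖x₀‖) • x₀) (by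
    rw [norm_smul, Real.norm_of_nonneg (by positivity), div_mul_cancel₀ _ hx₀pos.ne'])
  obtain ⟨g⟩ : Nonempty ((V.erase v₀) ↪ Fin (n - 1)) := by
    apply Function.Embedding.nonempty_of_card_le
    rw [Fintype.card_coe, Fintype.card_fin, Finset.card_erase_of_mem hv₀]
    omega
  set p : Fin (n - 1) → EuclideanSpace ℝ (Fin d) :=
    Function.extend g (fun v => R v) (fun _ => 0) with hp
  refine ⟨p, fun j => ?_, R v₀, ?_, ?_⟩
  · by_cases hj : ∃ v, g v = j
    · obtain ⟨v, rfl⟩ := hj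
      rw [hp, g.injective.extend_apply]
      simpa using hV1 (Finset.mem_of_mem_erase v.2)
    · rw [hp, Function.extend_apply' _ _ _ hj]
      simp
  · rw [hR, segment_eq_image]
    exact ⟨‖v₀‖ / ‖x₀‖, ⟨by positivity, div_le_one_of_le₀ (hv₀1.trans hx₀) hx₀pos.le⟩, by simp⟩
  · intro y hy
    have hy' : R.symm ((1 + ε) • y) ∈ Metric.closedBall (0 : EuclideanSpace ℝ (Fin d)) 1 := by
      rw [mem_closedBall_zero_iff] at hy ⊢
      rw [LinearIsometryEquiv.norm_map, norm_smul, Real.norm_of_nonneg hε1.le]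
      rwa [le_div_iff₀' hε1] at hy
    obtain ⟨u, hu, hux⟩ := Set.mem_smul_set.1 (hV hy')
    have hyu : y = R u := by
      have h1 : (1 + ε) • R u = (1 + ε) • y := by
        rw [← map_smul, hux, LinearIsometryEquiv.apply_symm_apply]
      exact (smul_right_injective _ hε1.ne' h1).symm
    have himg : R u ∈ convexHull ℝ (R '' V) := by
      have := (R.toLinearEquiv.toLinearMap).image_convexHull (V : Set (EuclideanSpace ℝ (Fin d)))
      exact this ▸ Set.mem_image_of_mem R hu
    rw [hyu]
    refine convexHull_mono ?_ himg
    rintro _ ⟨v, hv, rfl⟩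
    rcases eq_or_ne v v₀ with rfl | hne
    · exact Set.mem_insert _ _
    · refine Or.inr (Or.inr ⟨g ⟨v, Finset.mem_erase.2 ⟨hne, hv⟩⟩, ?_⟩)
      rw [hp, g.injective.extend_apply]

/-- Colorful quantitative Steinitz theorem for balls (Theorem 2.5). -/
theorem colorful_quantitative_steinitz_balls
    (d n : ℕ) (hd : 0 < d) (hn : 0 < n) (ε : ℝ) (hε : 0 < ε)
    (hprop : BallApproxProp d n ε)
    (X : Fin ((n - 1) * d + 1) → Set (EuclideanSpace ℝ (Fin d)))
    (hX : ∀ i, Metric.closedBall (0 : EuclideanSpace ℝ (Fin d)) 1 ⊆ convexHull ℝ (X i)) :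
    ∃ x : Fin ((n - 1) * d + 1) → EuclideanSpace ℝ (Fin d),
      (∀ i, x i ∈ X i) ∧
      Metric.closedBall (0 : EuclideanSpace ℝ (Fin d)) (1 / (1 + ε)) ⊆
        convexHull ℝ (Set.range x) := by
  obtain ⟨x₀, hx₀X, hx₀⟩ : ∃ x₀ ∈ X 0, 1 ≤ ‖x₀‖ := by
    set e : EuclideanSpace ℝ (Fin d) := EuclideanSpace.single ⟨0, hd⟩ 1
    have he : ‖e‖ = 1 := by simp [e]
    have hmem : e ∈ convexHull ℝ (X 0) := hX 0 (by simp [he])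
    obtain ⟨y, hy, hle⟩ := exists_inner_le_of_mem_convexHull hmem e
    refine ⟨y, hy, ?_⟩
    have := real_inner_le_norm e y
    rw [real_inner_self_eq_norm_sq, he] at hle
    rw [he] at this
    linarith
  obtain ⟨p, hp, q, hq, hball⟩ := hprop.exists_fin hε hx₀
  have hblock := fun j : Fin (n - 1) => colorful_caratheodory_insert_zero (ι := Fin d) (by simp)
    (fun i => X (finProdFinEquiv (j, i)).succ) (p j) fun i => hX _ (hp j)
  choose y hyX hyp using hblock
  set x : Fin ((n - 1) * d + 1) → EuclideanSpace ℝ (Fin d) :=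
    Fin.cons x₀ fun k => y (finProdFinEquiv.symm k).1 (finProdFinEquiv.symm k).2 with hx
  have hxsub : ∀ j, Set.range (y j) ⊆ Set.range x := by
    rintro j _ ⟨i, rfl⟩
    exact ⟨(finProdFinEquiv (j, i)).succ, by rw [hx, Fin.cons_succ, Equiv.symm_apply_apply]⟩
  have hsub : Metric.closedBall 0 (1 / (1 + ε)) ⊆ convexHull ℝ (insert 0 (Set.range x)) := by
    refine hball.trans (convexHull_min ?_ (convex_convexHull ℝ _))
    have h0 : (0 : EuclideanSpace ℝ (Fin d)) ∈ convexHull ℝ (insert 0 (Set.range x)) :=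
      subset_convexHull ℝ _ (Set.mem_insert _ _)
    refine Set.insert_subset ?_ (Set.insert_subset h0 ?_)
    · exact (convex_convexHull ℝ _).segment_subset h0
        (subset_convexHull ℝ _ (Set.mem_insert_of_mem _ ⟨0, rfl⟩)) hq
    · rintro _ ⟨j, rfl⟩
      exact convexHull_mono (Set.insert_subset_insert (hxsub j)) (hyp j)
  refine ⟨x, ?_, ?_⟩
  · refine Fin.cases hx₀X fun k => ?_
    have := hyX (finProdFinEquiv.symm k).1 (finProdFinEquiv.symm k).2
    rwa [Prod.mk.eta, Equiv.apply_symm_apply] at this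
  · rwa [convexHull_insert_zero_of_closedBall_subset (Set.finite_range x)
      (Set.range_nonempty x) (by positivity) hsub] at hsub
end

section
/- For every positive integer d and every ε > 0 there exists a positive integer n such that the following holds. Let F_1, …, F_n be finite nonempty families of convex sets in ℝ^d such that for every choice K_1 ∈ F_1, …, K_n ∈ F_n we have vol(K_1 ∩ K_2 ∩ … ∩ K_n) ≥ 1. Then there exists an index i ∈ {1, …, n} such that vol(⋂F_i) ≥ 1/(1 + ε). -/
open MeasureTheory

theorem IsCompact.exists_isCompact_convex_between {E : Type*} [NormedAddCommGroup E]
    [NormedSpace ℝ E] [FiniteDimensional ℝ E] {T U : Set E} (hT : IsCompact T) (hU : IsOpen U)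
    (hUc : Convex ℝ U) (hTU : T ⊆ U) : ∃ L, IsCompact L ∧ Convex ℝ L ∧ T ⊆ L ∧ L ⊆ U := by
  obtain ⟨A, hA, hAU, hTA⟩ : ∃ A : Set E, A.Finite ∧ A ⊆ U ∧ T ⊆ convexHull ℝ A := by
    refine hT.induction_on (p := fun S => ∃ A : Set E, A.Finite ∧ A ⊆ U ∧ S ⊆ convexHull ℝ A)
      ⟨∅, Set.finite_empty, Set.empty_subset _, Set.empty_subset _⟩ ?_ ?_ ?_
    · rintro S S' hS ⟨A, hA, hAU, h⟩
      exact ⟨A, hA, hAU, hS.trans h⟩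
    · rintro S S' ⟨A, hA, hAU, h⟩ ⟨A', hA', hAU', h'⟩
      exact ⟨A ∪ A', hA.union hA', Set.union_subset hAU hAU', Set.union_subset
        (h.trans (convexHull_mono Set.subset_union_left))
        (h'.trans (convexHull_mono Set.subset_union_right))⟩
    · intro x hx
      obtain ⟨b, hb, hbU⟩ := exists_mem_interior_convexHull_affineBasis (hU.mem_nhds (hTU hx))
      exact ⟨interior (convexHull ℝ (Set.range b)),
        mem_nhdsWithin_of_mem_nhds (isOpen_interior.mem_nhds hb), Set.range b,
        Set.finite_range b, (subset_convexHull ℝ _).trans hbU, interior_subset⟩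
  exact ⟨convexHull ℝ A, hA.isCompact_convexHull ℝ, convex_convexHull ℝ A, hTA,
    convexHull_min hAU hUc⟩

section Depth

variable {E : Type*} [NormedAddCommGroup E] [NormedSpace ℝ E] [FiniteDimensional ℝ E]
  [MeasurableSpace E] [BorelSpace E] (μ : Measure E) [μ.IsAddHaarMeasure]

theorem Convex.exists_isCompact_convex_measure_diff_lt {C K : Set E} (hK : Convex ℝ K)
    (hC : μ C ≠ ⊤) {q : ENNReal} (hq : μ (C \ K) < q) :
    ∃ L, IsCompact L ∧ Convex ℝ L ∧ L ⊆ K ∧ μ (C \ L) < q := by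
  have : IsFiniteMeasure (μ.restrict C) := ⟨by simpa using hC.lt_top⟩
  obtain ⟨T, hTK, hT, hlt⟩ := isOpen_interior.measurableSet.exists_isCompact_sdiff_lt
    (μ := μ.restrict C) (measure_ne_top _ (interior K)) (tsub_pos_of_lt hq).ne'
  obtain ⟨L, hL, hLc, hTL, hLK⟩ :=
    hT.exists_isCompact_convex_between isOpen_interior hK.interior hTK
  refine ⟨L, hL, hLc, hLK.trans interior_subset, ?_⟩
  rw [Measure.restrict_apply (isOpen_interior.measurableSet.diff hT.measurableSet)] at hlt
  have hsub : C \ L ⊆ (C \ K ∪ frontier K) ∪ ((interior K \ T) ∩ C) := by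
    rintro x ⟨hxC, hxL⟩
    by_cases hxK : x ∈ K
    · by_cases hxi : x ∈ interior K
      · exact Or.inr ⟨⟨hxi, fun h => hxL (hTL h)⟩, hxC⟩
      · exact Or.inl (Or.inr ⟨subset_closure hxK, hxi⟩)
    · exact Or.inl (Or.inl ⟨hxC, hxK⟩)
  calc μ (C \ L) ≤ (μ (C \ K) + μ (frontier K)) + μ ((interior K \ T) ∩ C) :=
        (measure_mono hsub).trans ((measure_union_le _ _).trans
          (add_le_add_left (measure_union_le _ _) _))
    _ = μ (C \ K) + μ ((interior K \ T) ∩ C) := by rw [hK.addHaar_frontier μ, add_zero]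
    _ < μ (C \ K) + (q - μ (C \ K)) := ENNReal.add_lt_add_left hq.ne_top hlt
    _ = q := add_tsub_cancel_of_le hq.le

theorem exists_forall_mem_of_measure_diff_lt {C : Set E} (hC : μ C ≠ ⊤) :
    ∃ z : E, ∀ K : Set E, Convex ℝ K →
      μ (C \ K) < μ C / (Module.finrank ℝ E + 1 : ℕ) → z ∈ K := by
  set q := μ C / (Module.finrank ℝ E + 1 : ℕ) with hq
  obtain ⟨z, hz⟩ := Convex.helly_theorem_compact' (𝕜 := ℝ)
    (F := fun L : {L : Set E // IsCompact L ∧ Convex ℝ L ∧ μ (C \ L) < q} => L.1)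
    (fun L => L.2.2.1) (fun L => L.2.1) (by
      intro I hI
      rcases I.eq_empty_or_nonempty with rfl | hne
      · simp
      by_contra hemp
      rw [Set.not_nonempty_iff_eq_empty] at hemp
      have hsub : C ⊆ ⋃ L ∈ I, C \ L.1 := by
        intro x hx
        have : x ∉ ⋂ L ∈ I, L.1 := by rw [hemp]; exact Set.notMem_empty x
        simp only [Set.mem_iInter, not_forall] at this
        obtain ⟨L, hL, hxL⟩ := this
        exact Set.mem_biUnion hL ⟨hx, hxL⟩
      refine lt_irrefl (μ C) ?_
      calc μ C ≤ ∑ L ∈ I, μ (C \ L.1) :=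
            (measure_mono hsub).trans (measure_biUnion_finset_le _ _)
        _ < ∑ L ∈ I, q := ENNReal.sum_lt_sum_of_nonempty hne fun L _ => L.2.2.2
        _ = I.card * q := by simp
        _ ≤ (Module.finrank ℝ E + 1 : ℕ) * q := by gcongr
        _ = μ C := by
            rw [hq, ENNReal.mul_div_cancel (by simp) (by simp)])
  refine ⟨z, fun K hK hlt => ?_⟩
  obtain ⟨L, hL, hLc, hLK, hlt'⟩ := hK.exists_isCompact_convex_measure_diff_lt μ hC hlt
  exact hLK (Set.mem_iInter.1 hz ⟨L, hL, hLc, hlt'⟩)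

/-- If each member of a family of convex sets misses only a small part of a convex set `C` of
finite volume, then the family contains a common slightly shrunk homothetic copy of `C`. -/
theorem le_measure_iInter_of_measure_diff_lt {ι : Type*} {C : Set E} (hCc : Convex ℝ C)
    (hC : μ C ≠ ⊤) {s : ℝ} (hs : 0 < s) (hs1 : s < 1) {K : ι → Set E}
    (hK : ∀ i, Convex ℝ (K i))
    (hlt : ∀ i, μ (C \ K i) <
      ENNReal.ofReal (s ^ Module.finrank ℝ E) * (μ C / (Module.finrank ℝ E + 1 : ℕ))) :
    ENNReal.ofReal ((1 - s) ^ Module.finrank ℝ E) * μ C ≤ μ (⋂ i, K i) := by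
  obtain ⟨z, hz⟩ := exists_forall_mem_of_measure_diff_lt μ hC
  have hsub : AffineMap.homothety z (1 - s) '' C ⊆ ⋂ i, K i := by
    rintro _ ⟨y, hy, rfl⟩
    refine Set.mem_iInter.2 fun i => ?_
    have hmem : z ∈ AffineMap.homothety y s ⁻¹' K i := by
      refine hz _ ((hK i).affine_preimage _) ?_
      have himg : AffineMap.homothety y s '' (C \ AffineMap.homothety y s ⁻¹' K i) ⊆ C \ K i := by
        rintro _ ⟨w, ⟨hw, hwK⟩, rfl⟩
        refine ⟨?_, hwK⟩
        rw [AffineMap.homothety_eq_lineMap]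
        exact hCc.lineMap_mem hy hw ⟨hs.le, hs1.le⟩
      have hle := (measure_mono himg).trans_lt (hlt i)
      rw [Measure.addHaar_image_homothety, abs_of_pos (pow_pos hs _)] at hle
      exact lt_of_mul_lt_mul_left' hle
    have heq : AffineMap.homothety z (1 - s) y = AffineMap.homothety y s z := by
      rw [AffineMap.homothety_eq_lineMap, AffineMap.homothety_eq_lineMap,
        AffineMap.lineMap_apply_one_sub]
    rw [heq]
    exact hmem
  calc _ = μ (AffineMap.homothety z (1 - s) '' C) := by
        rw [Measure.addHaar_image_homothety, abs_of_pos (pow_pos (by linarith) _)]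
    _ ≤ _ := measure_mono hsub

end Depth

section Colorful

theorem zero_mem_convexHull_range_rainbow_of_innerProductSpace {V : Type*} [NormedAddCommGroup V]
    [InnerProductSpace ℝ V] [FiniteDimensional ℝ V] {n : ℕ} (hn : Module.finrank ℝ V + 1 < n)
    {ι : Fin n → Type*} [∀ i, Finite (ι i)] (v : ∀ i, ι i → V)
    (h0 : ∀ i, (0 : V) ∈ convexHull ℝ (Set.range (v i))) :
    ∃ x : ∀ i, ι i, (0 : V) ∈ convexHull ℝ (Set.range fun i => v i (x i)) := by
  classical
  have hne : ∀ i, Nonempty (ι i) := fun i =>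
    Set.range_nonempty_iff_nonempty.1 (convexHull_nonempty_iff.1 ⟨0, h0 i⟩)
  have : NeZero n := ⟨by omega⟩
  let S : Set V := ⋃ x : (∀ i, ι i), convexHull ℝ (Set.range fun i => v i (x i))
  have hS : IsCompact S := isCompact_iUnion fun x => (Set.finite_range _).isCompact_convexHull ℝ
  have hSne : S.Nonempty := by
    obtain ⟨x⟩ : Nonempty (∀ i, ι i) := inferInstance
    exact ⟨v 0 (x 0), Set.mem_iUnion.2 ⟨x, subset_convexHull ℝ _ ⟨0, rfl⟩⟩⟩
  obtain ⟨p, hpS, hp⟩ := hS.exists_isMinOn hSne continuous_norm.continuousOn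
  obtain ⟨x, hx⟩ := Set.mem_iUnion.1 hpS
  refine ⟨x, ?_⟩
  by_contra hx0
  have hp0 : p ≠ 0 := fun h => hx0 (h ▸ hx)
  rw [convexHull_eq_union] at hx
  simp only [Set.mem_iUnion] at hx
  obtain ⟨t, ht, hind, hpt⟩ := hx
  have htcard : t.card ≤ Module.finrank ℝ V + 1 := by
    have := hind.card_le_finrank_succ
    simp only [Fintype.card_coe] at this
    exact this.trans (by gcongr; exact Submodule.finrank_le _)
  choose f hf using fun y : t => ht y.2
  obtain ⟨i, hi⟩ : ∃ i : Fin n, i ∉ Finset.univ.image f := by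
    by_contra! hall
    have h1 : (Finset.univ : Finset (Fin n)) ⊆ Finset.univ.image f := fun i _ => hall i
    have h2 := (Finset.card_le_card h1).trans Finset.card_image_le
    simp at h2
    omega
  obtain ⟨k, hk⟩ : ∃ k, inner ℝ p (v i k) ≤ 0 := by
    by_contra! hpos
    have hconv : Convex ℝ {y : V | 0 < inner ℝ p y} :=
      convex_halfSpace_gt (innerₗ V p).isLinear 0
    have hsub : Set.range (v i) ⊆ {y : V | 0 < inner ℝ p y} := Set.range_subset_iff.2 hpos
    simpa using convexHull_min hsub hconv (h0 i)
  have hseg : segment ℝ p (v i k) ⊆ S := by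
    refine subset_trans ?_ (Set.subset_iUnion _ (Function.update x i k))
    refine (convex_convexHull ℝ _).segment_subset ?_ (subset_convexHull ℝ _ ⟨i, by simp⟩)
    refine convexHull_mono ?_ hpt
    intro y hy
    refine ⟨f ⟨y, hy⟩, ?_⟩
    have hne : f ⟨y, hy⟩ ≠ i := fun h => hi (Finset.mem_image.2 ⟨_, Finset.mem_univ _, h⟩)
    simpa [Function.update_of_ne hne] using hf ⟨y, hy⟩
  have hmin := (norm_eq_iInf_iff_real_inner_le_zero (u := (0 : V)) (convex_segment p (v i k))
    (left_mem_segment ℝ p _)).1 (by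
      have : Nonempty (segment ℝ p (v i k)) := ⟨⟨p, left_mem_segment ℝ p _⟩⟩
      refine le_antisymm (le_ciInf fun w => ?_)
        (ciInf_le (f := fun w : segment ℝ p (v i k) => ‖(0 : V) - w‖) ⟨0, ?_⟩
          ⟨p, left_mem_segment ℝ p _⟩)
      · simpa using hp (hseg w.2)
      · rintro _ ⟨w, rfl⟩
        exact norm_nonneg _) (v i k) (right_mem_segment ℝ p _)
  have hpp : 0 < inner ℝ p p := real_inner_self_pos.2 hp0
  simp only [zero_sub, inner_neg_left, inner_sub_right] at hmin
  linarith

/-- The colorful Carathéodory theorem, with one more color than necessary. -/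
theorem zero_mem_convexHull_range_rainbow {V : Type*} [NormedAddCommGroup V]
    [NormedSpace ℝ V] [FiniteDimensional ℝ V] {n : ℕ} (hn : Module.finrank ℝ V + 1 < n)
    {ι : Fin n → Type*} [∀ i, Finite (ι i)] (v : ∀ i, ι i → V)
    (h0 : ∀ i, (0 : V) ∈ convexHull ℝ (Set.range (v i))) :
    ∃ x : ∀ i, ι i, (0 : V) ∈ convexHull ℝ (Set.range fun i => v i (x i)) := by
  let e : V ≃ₗ[ℝ] EuclideanSpace ℝ (Fin (Module.finrank ℝ V)) :=
    (toEuclidean (E := V)).toLinearEquiv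
  have key : ∀ S : Set V, (0 : V) ∈ convexHull ℝ S ↔ 0 ∈ convexHull ℝ (e '' S) := by
    intro S
    have himg := e.toLinearMap.image_convexHull S
    simp only [LinearEquiv.coe_coe] at himg
    rw [← himg]
    constructor
    · exact fun h => ⟨0, h, map_zero e⟩
    · rintro ⟨y, hy, hy0⟩
      rwa [e.map_eq_zero_iff.1 hy0] at hy
  obtain ⟨x, hx⟩ := zero_mem_convexHull_range_rainbow_of_innerProductSpace (by simpa using hn)
    (fun i k => e (v i k)) fun i => by
      have := (key _).1 (h0 i)
      rwa [← Set.range_comp] at this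
  refine ⟨x, (key _).2 ?_⟩
  rwa [← Set.range_comp]

/-- Finitely many compact convex sets without a common point lie in open half-spaces whose
defining affine functionals sum to zero. -/
theorem exists_affine_functionals_sum_eq_zero {W : Type*} [NormedAddCommGroup W]
    [NormedSpace ℝ W] [FiniteDimensional ℝ W] {κ : Type*} [Fintype κ] [Nonempty κ]
    {T : κ → Set W} (hT : ∀ k, IsCompact (T k)) (hTc : ∀ k, Convex ℝ (T k))
    (hTne : ∀ k, (T k).Nonempty) (hemp : ¬ (⋂ k, T k).Nonempty) :
    ∃ φ : κ → (W →L[ℝ] ℝ) × ℝ, ∑ k, φ k = 0 ∧ ∀ k, ∀ w ∈ T k, (φ k).2 < (φ k).1 w := by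
  classical
  let D : Submodule ℝ (κ → W) := LinearMap.range (LinearMap.pi fun _ : κ => LinearMap.id)
  have hdisj : Disjoint (Set.univ.pi T) (D : Set (κ → W)) := by
    refine Set.disjoint_left.2 ?_
    rintro _ h ⟨w, rfl⟩
    exact hemp ⟨w, Set.mem_iInter.2 fun k => h k (Set.mem_univ k)⟩
  obtain ⟨f, u, c, hfu, huc, hcf⟩ := geometric_hahn_banach_compact_closed
    (convex_pi fun k _ => hTc k) (isCompact_univ_pi hT) D.convex D.closed_of_finiteDimensional hdisj
  have hc0 : c < 0 := by simpa using hcf 0 D.zero_mem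
  have hfD : ∀ w : W, f (fun _ => w) = 0 := by
    intro w
    by_contra hne
    have hmem : (fun _ => (c / f fun _ => w) • w : κ → W) ∈ (D : Set (κ → W)) := ⟨_, rfl⟩
    have h := hcf _ hmem
    have hsm : (fun _ => (c / f fun _ => w) • w : κ → W) = (c / f fun _ => w) • fun _ => w := rfl
    rw [hsm, map_smul, smul_eq_mul, div_mul_cancel₀ _ hne] at h
    exact lt_irrefl _ h
  let g : κ → (W →L[ℝ] ℝ) := fun k =>
    -(f.comp (ContinuousLinearMap.single ℝ (fun _ : κ => W) k))
  have hg : ∀ w : κ → W, ∑ k, g k (w k) = -f w := by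
    intro w
    simp only [g, neg_apply, ContinuousLinearMap.comp_apply,
      ContinuousLinearMap.single_apply, Finset.sum_neg_distrib]
    rw [← map_sum, Finset.univ_sum_single]
  choose w hwT hw using fun k =>
    (hT k).exists_isMinOn (hTne k) (g k).continuous.continuousOn
  set s : ℝ := ∑ k, g k (w k) with hs
  have hspos : 0 < s := by
    rw [hs, hg]
    have := hfu w fun k _ => hwT k
    linarith
  have hcard : (0 : ℝ) < Fintype.card κ := by exact_mod_cast Fintype.card_pos
  refine ⟨fun k => (g k, g k (w k) - s / Fintype.card κ), ?_, ?_⟩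
  · refine Prod.ext ?_ ?_
    · rw [Prod.fst_sum]
      ext y
      have := hg fun _ => y
      rw [hfD, neg_zero] at this
      simpa using this
    · rw [Prod.snd_sum]
      simp only [Finset.sum_sub_distrib, ← hs, Finset.sum_const, Finset.card_univ, nsmul_eq_mul]
      rw [mul_div_cancel₀ _ hcard.ne']
      simp
  · intro k y hy
    have h1 : g k (w k) ≤ g k y := hw k hy
    have h2 := div_pos hspos hcard
    simp only
    linarith

/-- A colorful Helly theorem. -/
theorem exists_iInter_nonempty_of_rainbow {W : Type*} [NormedAddCommGroup W]
    [NormedSpace ℝ W] [FiniteDimensional ℝ W] {n : ℕ}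
    (hn : Module.finrank ℝ ((W →L[ℝ] ℝ) × ℝ) + 1 < n) {ι : Fin n → Type*}
    [∀ i, Finite (ι i)] [∀ i, Nonempty (ι i)] {A : ∀ i, ι i → Set W}
    (hA : ∀ i k, Convex ℝ (A i k))
    (h : ∀ x : ∀ i, ι i, (⋂ i, A i (x i)).Nonempty) : ∃ i, (⋂ k, A i k).Nonempty := by
  classical
  have := fun i => Fintype.ofFinite (ι i)
  choose p hp using h
  let T : ∀ i, ι i → Set W := fun i k => convexHull ℝ (p '' {x | x i = k})
  have hTA : ∀ i k, T i k ⊆ A i k := by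
    intro i k
    refine convexHull_min ?_ (hA i k)
    rintro _ ⟨x, rfl, rfl⟩
    exact Set.mem_iInter.1 (hp x) i
  have hpT : ∀ x i, p x ∈ T i (x i) := fun x i => subset_convexHull ℝ _ ⟨x, rfl, rfl⟩
  by_contra! hno
  have hTemp : ∀ i, ¬ (⋂ k, T i k).Nonempty := by
    rintro i ⟨y, hy⟩
    have : y ∈ ⋂ k, A i k := Set.iInter_mono (hTA i) hy
    rw [hno i] at this
    exact this
  have hTne : ∀ i k, (T i k).Nonempty := by
    intro i k
    obtain ⟨x⟩ : Nonempty (∀ i, ι i) := inferInstance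
    exact ⟨_, by simpa using hpT (Function.update x i k) i⟩
  choose φ hφ0 hφ using fun i => exists_affine_functionals_sum_eq_zero
    (fun k => (Set.toFinite (p '' {x | x i = k})).isCompact_convexHull ℝ)
    (fun k => convex_convexHull ℝ _) (hTne i) (hTemp i)
  obtain ⟨x, hx⟩ := zero_mem_convexHull_range_rainbow hn φ (by
    intro i
    have hcard : (0 : ℝ) < Fintype.card (ι i) := by exact_mod_cast Fintype.card_pos
    refine mem_convexHull_of_exists_fintype (fun _ => (Fintype.card (ι i) : ℝ)⁻¹) (φ i)
      (fun _ => by positivity) ?_ (fun k => ⟨k, rfl⟩) ?_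
    · simp [hcard.ne']
    · rw [← Finset.smul_sum, hφ0 i, smul_zero])
  let ev : ((W →L[ℝ] ℝ) × ℝ) →ₗ[ℝ] ℝ :=
    { toFun := fun ψ => ψ.1 (p x) - ψ.2
      map_add' := fun a b => by simp; ring
      map_smul' := fun a b => by simp; ring }
  have hconv : Convex ℝ {ψ | 0 < ev ψ} := convex_halfSpace_gt ev.isLinear 0
  have hlt : (0 : (W →L[ℝ] ℝ) × ℝ) ∈ {ψ | 0 < ev ψ} := by
    refine convexHull_min ?_ hconv hx
    rintro _ ⟨i, rfl⟩
    have := hφ i (x i) (p x) (hpT x i)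
    simpa [ev] using this
  simp at hlt

end Colorful

section TriangularFrame

theorem volume_eq_lintegral_volume_cons_preimage {d : ℕ} {U : Set (Fin (d + 1) → ℝ)}
    (hU : MeasurableSet U) :
    volume U = ∫⁻ t : ℝ, volume {y : Fin d → ℝ | Fin.cons t y ∈ U} := by
  have hmp := (volume_preserving_piFinSuccAbove (fun _ : Fin (d + 1) => ℝ) 0).symm
  rw [← hmp.measure_preimage_equiv, Measure.volume_eq_prod,
    Measure.prod_apply (hU.preimage (MeasurableEquiv.measurable _))]
  refine lintegral_congr fun t => congrArg volume ?_
  ext y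
  simp [MeasurableEquiv.piFinSuccAbove_symm_apply, Fin.consEquiv]

theorem exists_triangular_frame (d : ℕ) : ∃ c : ℝ, 0 < c ∧ ∀ U : Set (Fin d → ℝ), IsOpen U →
    Convex ℝ U → Bornology.IsBounded U → ∀ V : ℝ, 0 < V → ENNReal.ofReal V ≤ volume U →
    ∃ (b : Fin d → ℝ) (A : Fin d → Fin d → ℝ), b ∈ U ∧ (∀ j, b + A j ∈ U) ∧
      (∀ j k, k < j → A j k = 0) ∧ (∀ j, 0 < A j j) ∧ c * V ≤ ∏ j, A j j := by
  induction d with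
  | zero =>
    refine ⟨1, one_pos, fun U _ _ _ V hV hVU => ?_⟩
    have hpos : 0 < volume U := (ENNReal.ofReal_pos.2 hV).trans_le hVU
    obtain ⟨b, hb⟩ := nonempty_of_measure_ne_zero hpos.ne'
    refine ⟨b, fun _ _ => 0, hb, fun j => j.elim0, fun j => j.elim0, fun j => j.elim0, ?_⟩
    have hle : volume U ≤ 1 := by
      refine (measure_mono (Set.subset_univ U)).trans ?_
      simp [volume_pi]
    have := hVU.trans hle
    rw [ENNReal.ofReal_le_one] at this
    simpa using this
  | succ d ih =>
    obtain ⟨c, hc, ih⟩ := ih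
    refine ⟨c * (1 / 4) * ((1 / 2) ^ (d + 1) / 2), by positivity, ?_⟩
    intro U hU hUc hUb V hV hVU
    have hpos : 0 < volume U := (ENNReal.ofReal_pos.2 hV).trans_le hVU
    have hUne := nonempty_of_measure_ne_zero hpos.ne'
    set P : Set ℝ := (fun u : Fin (d + 1) → ℝ => u 0) '' U
    have hPne : P.Nonempty := hUne.image _
    have hPo : IsOpen P := isOpenMap_eval 0 U hU
    have hPb : Bornology.IsBounded P := by
      obtain ⟨R, hR⟩ := isBounded_iff_forall_norm_le.1 hUb
      refine isBounded_iff_forall_norm_le.2 ⟨R, ?_⟩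
      rintro _ ⟨u, hu, rfl⟩
      exact (norm_le_pi_norm u 0).trans (hR u hu)
    set a := sInf P
    set b := sSup P
    have ha : ∀ u ∈ U, a ≤ u 0 := fun u hu => csInf_le hPb.bddBelow ⟨u, hu, rfl⟩
    have hb : ∀ u ∈ U, u 0 ≤ b := fun u hu => le_csSup hPb.bddAbove ⟨u, hu, rfl⟩
    have hL : 0 < b - a := by
      have h1 : 0 < volume P := hPo.measure_pos volume hPne
      have h2 : volume P ≤ ENNReal.ofReal (b - a) := by
        rw [← Real.volume_Icc]
        refine measure_mono ?_
        rintro _ ⟨u, hu, rfl⟩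
        exact ⟨ha u hu, hb u hu⟩
      exact ENNReal.ofReal_pos.1 (h1.trans_le h2)
    set L := b - a with hLdef
    obtain ⟨_, ⟨x₀, hx₀, rfl⟩, hx₀a⟩ := exists_lt_of_csInf_lt hPne (show a < a + L / 8 by linarith)
    obtain ⟨_, ⟨x₁, hx₁, rfl⟩, hx₁b⟩ := exists_lt_of_lt_csSup hPne (show b - L / 8 < b by linarith)
    simp only at hx₀a hx₁b
    let U' : Set (Fin (d + 1) → ℝ) := {y | (2 : ℝ) • y - x₀ ∈ U}
    have hUopen : IsOpen U' := hU.preimage (by fun_prop)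
    have hUsub : U' ⊆ U := by
      intro y hy
      have := hUc.midpoint_mem hx₀ hy
      convert this using 1
      ext i
      simp [midpoint_eq_smul_add]
    have hUconv : Convex ℝ U' := by
      intro y hy z hz s t hs ht hst
      have := hUc hy hz hs ht hst
      have h : s • ((2 : ℝ) • y - x₀) + t • ((2 : ℝ) • z - x₀) =
          (2 : ℝ) • (s • y + t • z) - (s + t) • x₀ := by module
      rw [h, hst, one_smul] at this
      exact this
    have hUvol : ENNReal.ofReal ((1 / 2) ^ (d + 1) * V) ≤ volume U' := by
      calc ENNReal.ofReal ((1 / 2) ^ (d + 1) * V)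
          ≤ ENNReal.ofReal ((1 / 2) ^ (d + 1)) * volume U := by
            rw [ENNReal.ofReal_mul (by positivity)]
            gcongr
        _ = volume (AffineMap.homothety x₀ (1 / 2 : ℝ) '' U) := by
            rw [Measure.addHaar_image_homothety, abs_of_pos (by positivity)]
            simp
        _ ≤ volume U' := by
            refine measure_mono ?_
            rintro _ ⟨u, hu, rfl⟩
            have : (2 : ℝ) • AffineMap.homothety x₀ (1 / 2 : ℝ) u - x₀ = u := by
              ext i
              simp [AffineMap.homothety_apply]
              ring
            simpa only [U', Set.mem_ofPred_eq, this] using hu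
    set m := (1 / 2) ^ (d + 1) * V / (2 * L) with hm
    have hmpos : 0 < m := by positivity
    obtain ⟨t, ht⟩ : ∃ t : ℝ, ENNReal.ofReal m ≤ volume {y : Fin d → ℝ | Fin.cons t y ∈ U'} := by
      by_contra! hlt
      have hbound : volume U' ≤ ENNReal.ofReal m * ENNReal.ofReal L := by
        rw [volume_eq_lintegral_volume_cons_preimage hUopen.measurableSet, ← Real.volume_Icc,
          ← lintegral_indicator_const measurableSet_Icc]
        refine lintegral_mono fun t => ?_
        by_cases ht : t ∈ Set.Icc a b
        · rw [Set.indicator_of_mem ht]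
          exact (hlt t).le
        · rw [Set.indicator_of_notMem ht]
          have : {y : Fin d → ℝ | Fin.cons t y ∈ U'} = ∅ := by
            refine Set.eq_empty_of_forall_notMem fun y hy => ht ?_
            exact ⟨by simpa using ha _ (hUsub hy), by simpa using hb _ (hUsub hy)⟩
          simp only [this, measure_empty, le_refl]
      have h := hUvol.trans hbound
      rw [← ENNReal.ofReal_mul hmpos.le, ENNReal.ofReal_le_ofReal_iff (by positivity)] at h
      have h2 : m * L = (1 / 2) ^ (d + 1) * V / 2 := by rw [hm]; field_simp
      have h3 : 0 < (1 / 2 : ℝ) ^ (d + 1) * V := by positivity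
      linarith
    obtain ⟨b', A', hb', hbA', hAzero, hApos, hA'⟩ := ih {y : Fin d → ℝ | Fin.cons t y ∈ U'}
      (hUopen.preimage (by fun_prop)) (by
        intro y hy z hz s r hs hr hsr
        have := hUconv hy hz hs hr hsr
        have h : s • (Fin.cons t y : Fin (d + 1) → ℝ) + r • (Fin.cons t z : Fin (d + 1) → ℝ) =
            Fin.cons t (s • y + r • z) := by
          ext i
          refine Fin.cases ?_ (fun i => ?_) i
          · simp [← add_mul, hsr]
          · simp
        rw [h] at this
        exact this) (by
        obtain ⟨R, hR⟩ := isBounded_iff_forall_norm_le.1 hUb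
        refine isBounded_iff_forall_norm_le.2 ⟨R, fun y hy => ?_⟩
        refine le_trans ?_ (hR _ (hUsub hy))
        refine (pi_norm_le_iff_of_nonneg (norm_nonneg _)).2 fun i => ?_
        simpa using norm_le_pi_norm (Fin.cons t y : Fin (d + 1) → ℝ) i.succ) m hmpos ht
    have htb : t ≤ (b + a + L / 8) / 2 := by
      have h : (2 : ℝ) * t - x₀ 0 ≤ b := by simpa using hb _ hb'
      linarith
    have hgap : L / 4 ≤ x₁ 0 - t := by linarith
    have hbmem : (Fin.cons t b' : Fin (d + 1) → ℝ) ∈ U := hUsub hb'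
    refine ⟨Fin.cons t b', Fin.cons (x₁ - Fin.cons t b') fun j => Fin.cons 0 (A' j), hbmem,
      ?_, ?_, ?_, ?_⟩
    · intro j
      refine Fin.cases ?_ (fun j => ?_) j
      · simpa using hx₁
      · have := hUsub (hbA' j)
        convert this using 1
        ext i
        refine Fin.cases ?_ (fun i => ?_) i <;> simp
    · intro j
      refine Fin.cases (fun k hk => absurd hk (Fin.not_lt_zero k)) (fun j k => ?_) j
      refine Fin.cases (fun _ => by simp) (fun k hk => ?_) k
      simpa using hAzero j k (Fin.succ_lt_succ_iff.1 hk)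
    · intro j
      refine Fin.cases ?_ (fun j => ?_) j
      · simp
        linarith
      · simpa using hApos j
    · rw [Fin.prod_univ_succ]
      simp only [Fin.cons_zero, Fin.cons_succ, Pi.sub_apply]
      calc c * (1 / 4) * ((1 / 2) ^ (d + 1) / 2) * V = L / 4 * (c * m) := by
            rw [hm]; field_simp
        _ ≤ (x₁ 0 - t) * ∏ j, A' j j := by
            gcongr
            linarith

theorem Convex.exists_isBounded_isOpen_subset {d : ℕ} {K : Set (Fin d → ℝ)} (hK : Convex ℝ K)
    {r : ENNReal} (hr : r < volume K) :
    ∃ U ⊆ K, IsOpen U ∧ Convex ℝ U ∧ Bornology.IsBounded U ∧ r < volume U := by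
  have hint : volume K ≤ volume (interior K) := by
    calc volume K ≤ volume (interior K ∪ frontier K) := by
          refine measure_mono fun x hx => ?_
          by_cases h : x ∈ interior K
          · exact Or.inl h
          · exact Or.inr ⟨subset_closure hx, h⟩
      _ ≤ volume (interior K) + volume (frontier K) := measure_union_le _ _
      _ = volume (interior K) := by rw [hK.addHaar_frontier volume, add_zero]
  have hU : interior K = ⋃ n : ℕ, interior K ∩ Metric.ball 0 n := by
    rw [← Set.inter_iUnion, Metric.iUnion_ball_nat, Set.inter_univ]
  have hmono : Monotone fun n : ℕ => interior K ∩ Metric.ball (0 : Fin d → ℝ) n :=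
    fun n m h => Set.inter_subset_inter_right _ (Metric.ball_subset_ball (by exact_mod_cast h))
  have hlt := hr.trans_le hint
  rw [hU, hmono.measure_iUnion, lt_iSup_iff] at hlt
  obtain ⟨n, hn⟩ := hlt
  exact ⟨_, Set.inter_subset_left.trans interior_subset, isOpen_interior.inter Metric.isOpen_ball,
    hK.interior.inter (convex_ball _ _), Metric.isBounded_ball.subset Set.inter_subset_right, hn⟩

theorem one_le_volume_of_triangular_frame {d : ℕ} (hd : 0 < d) {K : Set (Fin d → ℝ)}
    (hK : Convex ℝ K) {b : Fin d → ℝ} {A : Fin d → Fin d → ℝ} (hb : b ∈ K)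
    (hbA : ∀ j, b + A j ∈ K) (hA0 : ∀ j k, k < j → A j k = 0)
    (hA : (d : ℝ) ^ d ≤ ∏ j, A j j) : 1 ≤ volume K := by
  have hd' : (0 : ℝ) < d := by exact_mod_cast hd
  let f : (Fin d → ℝ) →ₗ[ℝ] (Fin d → ℝ) := Matrix.toLin' (Matrix.of A).transpose
  have hf : ∀ x, f x = ∑ j, x j • A j := by
    intro x
    ext i
    simp [f, Matrix.mulVec, dotProduct, mul_comm]
  have hdet : LinearMap.det f = ∏ j, A j j := by
    rw [LinearMap.det_toLin', Matrix.det_transpose, Matrix.det_of_isUpperTriangular]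
    · simp
    · exact fun j k hjk => hA0 j k hjk
  have hsub : (fun y => b + y) '' (f '' Set.Icc 0 fun _ => (d : ℝ)⁻¹) ⊆ K := by
    rintro _ ⟨_, ⟨x, ⟨hx0, hx1⟩, rfl⟩, rfl⟩
    have hmem : ∑ j : Fin d, (d : ℝ)⁻¹ • (b + ((d : ℝ) * x j) • A j) ∈ K := by
      refine hK.sum_mem (fun _ _ => by positivity) (by simp [hd'.ne']) fun j _ => ?_
      refine hK.add_smul_mem hb (hbA j) ⟨mul_nonneg hd'.le (hx0 j), ?_⟩
      calc (d : ℝ) * x j ≤ d * (d : ℝ)⁻¹ := by gcongr; exact hx1 j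
        _ = 1 := mul_inv_cancel₀ hd'.ne'
    convert hmem using 1
    simp only [hf, smul_add, smul_smul, inv_mul_cancel_left₀ hd'.ne', Finset.sum_add_distrib,
      Finset.sum_const, Finset.card_univ, Fintype.card_fin]
    rw [← Nat.cast_smul_eq_nsmul ℝ, smul_smul, mul_inv_cancel₀ hd'.ne', one_smul]
  refine le_trans ?_ (measure_mono hsub)
  rw [Set.image_add_left, measure_preimage_add, Measure.addHaar_image_linearMap, hdet,
    Real.volume_Icc_pi]
  simp only [Pi.zero_apply, sub_zero, Finset.prod_const, Finset.card_univ, Fintype.card_fin]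
  rw [← ENNReal.ofReal_pow (by positivity), ← ENNReal.ofReal_mul (abs_nonneg _),
    ENNReal.one_le_ofReal, inv_pow, ← div_eq_mul_inv, one_le_div (by positivity)]
  exact hA.trans (le_abs_self _)

theorem convex_setOf_le_prod {ι : Type*} [Fintype ι] {P : ℝ} (hP : 0 < P) :
    Convex ℝ {x : ι → ℝ | (∀ i, 0 < x i) ∧ P ≤ ∏ i, x i} := by
  rintro x ⟨hx, hxP⟩ y ⟨hy, hyP⟩ s t hs ht hst
  refine ⟨fun i => ?_, ?_⟩
  · exact (convex_Ioi (0 : ℝ)) (hx i) (hy i) hs ht hst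
  · calc P = P ^ s * P ^ t := by rw [← Real.rpow_add hP, hst, Real.rpow_one]
      _ ≤ (∏ i, x i) ^ s * (∏ i, y i) ^ t := by
          have := Finset.prod_nonneg fun i (_ : i ∈ Finset.univ) => (hx i).le
          gcongr
      _ = ∏ i, x i ^ s * y i ^ t := by
          rw [← Real.finsetProd_rpow _ _ fun i _ => (hx i).le,
            ← Real.finsetProd_rpow _ _ fun i _ => (hy i).le, Finset.prod_mul_distrib]
      _ ≤ ∏ i, (s • x + t • y) i := by
          refine Finset.prod_le_prod (fun i _ => ?_) fun i _ => ?_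
          · have := hx i; have := hy i; positivity
          · exact Real.geom_mean_le_arith_mean2_weighted hs ht (hx i).le (hy i).le hst

theorem convex_triangular_frames {d : ℕ} {K : Set (Fin d → ℝ)} (hK : Convex ℝ K) {P : ℝ}
    (hP : 0 < P) : Convex ℝ {p : (Fin d → ℝ) × (Fin d → Fin d → ℝ) | p.1 ∈ K ∧
      (∀ j, p.1 + p.2 j ∈ K) ∧ (∀ j k, k < j → p.2 j k = 0) ∧ (∀ j, 0 < p.2 j j) ∧
      P ≤ ∏ j, p.2 j j} := by
  rintro ⟨b, A⟩ ⟨hb, hbA, hA0, hA⟩ ⟨b', A'⟩ ⟨hb', hbA', hA0', hA'⟩ s t hs ht hst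
  refine ⟨hK hb hb' hs ht hst, fun j => ?_, fun j k hjk => ?_, ?_⟩
  · have := hK (hbA j) (hbA' j) hs ht hst
    convert this using 1
    simp only [Prod.smul_mk, Prod.mk_add_mk, Pi.add_apply, Pi.smul_apply, smul_add]
    abel
  · have h1 := hA0 j k hjk
    have h2 := hA0' j k hjk
    simp only at h1 h2
    simp [h1, h2]
  · exact convex_setOf_le_prod hP (x := fun j => A j j) hA (y := fun j => A' j j) hA' hs ht hst

end TriangularFrame

section ColorfulVolume

theorem exists_one_le_volume_iInter_of_rainbow {d : ℕ} (hd : 0 < d) :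
    ∃ (n : ℕ) (M : ℝ), 0 < M ∧ ∀ (ι : Fin n → Type) [∀ i, Finite (ι i)] [∀ i, Nonempty (ι i)]
      (K : ∀ i, ι i → Set (EuclideanSpace ℝ (Fin d))), (∀ i k, Convex ℝ (K i k)) →
      (∀ x : ∀ i, ι i, ENNReal.ofReal M < volume (⋂ i, K i (x i))) →
      ∃ i, 1 ≤ volume (⋂ k, K i k) := by
  obtain ⟨c, hc, hframe⟩ := exists_triangular_frame d
  have hP : (0 : ℝ) < (d : ℝ) ^ d := pow_pos (by exact_mod_cast hd) d
  let W := (Fin d → ℝ) × (Fin d → Fin d → ℝ)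
  refine ⟨Module.finrank ℝ ((W →L[ℝ] ℝ) × ℝ) + 2, (d : ℝ) ^ d / c, by positivity, ?_⟩
  intro ι _ _ K hK hvol
  let e : (Fin d → ℝ) →ₗ[ℝ] EuclideanSpace ℝ (Fin d) :=
    (WithLp.linearEquiv 2 ℝ (Fin d → ℝ)).symm.toLinearMap
  have he : MeasurePreserving e := PiLp.volume_preserving_toLp (Fin d)
  have hKe : ∀ i k, Convex ℝ (e ⁻¹' K i k) := fun i k => (hK i k).linear_preimage e
  obtain ⟨i, ⟨b, A⟩, hbA⟩ := exists_iInter_nonempty_of_rainbow (W := W) (by omega)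
    (A := fun i k => {p : W | p.1 ∈ e ⁻¹' K i k ∧ (∀ j, p.1 + p.2 j ∈ e ⁻¹' K i k) ∧
      (∀ j k, k < j → p.2 j k = 0) ∧ (∀ j, 0 < p.2 j j) ∧ (d : ℝ) ^ d ≤ ∏ j, p.2 j j})
    (fun i k => convex_triangular_frames (hKe i k) hP) (by
      intro x
      have hlt := hvol x
      rw [← he.measure_preimage ((convex_iInter fun i => hK i (x i)).nullMeasurableSet volume),
        Set.preimage_iInter] at hlt
      obtain ⟨U, hUK, hU, hUc, hUb, hltU⟩ :=
        (convex_iInter fun i => hKe i (x i)).exists_isBounded_isOpen_subset hlt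
      obtain ⟨b, A, hb, hbA, hA0, hApos, hA⟩ := hframe U hU hUc hUb _ (by positivity) hltU.le
      rw [mul_div_cancel₀ _ hc.ne'] at hA
      exact ⟨(b, A), Set.mem_iInter.2 fun i => ⟨Set.mem_iInter.1 (hUK hb) i,
        fun j => Set.mem_iInter.1 (hUK (hbA j)) i, hA0, hApos, hA⟩⟩)
  refine ⟨i, ?_⟩
  rw [Set.mem_iInter] at hbA
  obtain ⟨k₀⟩ : Nonempty (ι i) := inferInstance
  rw [← he.measure_preimage ((convex_iInter fun k => hK i k).nullMeasurableSet volume),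
    Set.preimage_iInter]
  exact one_le_volume_of_triangular_frame hd (convex_iInter fun k => hKe i k)
    (Set.mem_iInter.2 fun k => (hbA k).1)
    (fun j => Set.mem_iInter.2 fun k => (hbA k).2.1 j) (hbA k₀).2.2.1 (hbA k₀).2.2.2.2

theorem exists_measure_inter_le_of_measure_iInter_lt {E : Type*} [NormedAddCommGroup E]
    [NormedSpace ℝ E] [FiniteDimensional ℝ E] [MeasurableSpace E] [BorelSpace E] (μ : Measure E)
    [μ.IsAddHaarMeasure] {ι : Type*} {C : Set E} (hCc : Convex ℝ C) (hC : μ C ≠ ⊤)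
    {s : ℝ} (hs : 0 < s) (hs1 : s < 1) {K : ι → Set E} (hK : ∀ i, Convex ℝ (K i))
    (hlt : μ (⋂ i, K i) < ENNReal.ofReal ((1 - s) ^ Module.finrank ℝ E) * μ C) :
    ∃ i, μ (C ∩ K i) ≤
      ENNReal.ofReal (1 - s ^ Module.finrank ℝ E / (Module.finrank ℝ E + 1 : ℕ)) * μ C := by
  by_contra! hno
  refine hlt.not_ge (le_measure_iInter_of_measure_diff_lt μ hCc hC hs hs1 hK fun i => ?_)
  by_contra! hle
  refine (hno i).not_ge ?_
  have hadd := measure_inter_add_sdiff₀ C ((hK i).nullMeasurableSet μ)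
  have hfin : μ (C \ K i) ≠ ⊤ := ne_top_of_le_ne_top hC (measure_mono Set.sdiff_subset)
  rw [ENNReal.eq_sub_of_add_eq hfin hadd, ENNReal.ofReal_sub _ (by positivity),
    ENNReal.sub_mul fun _ _ => hC, ENNReal.ofReal_one, one_mul]
  refine tsub_le_tsub_left ?_ _
  rwa [ENNReal.ofReal_div_of_pos (by positivity), ENNReal.ofReal_natCast,
    ENNReal.mul_comm_div]

end ColorfulVolume

/-- Colorful quantitative Helly theorem with volume (Theorem 3.6): for every `d` and
`ε > 0` there is an `n` such that if `F_1, …, F_n` are finite nonempty families of convex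
sets in `ℝ^d` and every rainbow intersection `K_1 ∩ … ∩ K_n` (with `K_i ∈ F_i`) has volume
at least `1`, then for some index `i` the intersection of the whole family `F_i` has
volume at least `1/(1 + ε)`. -/
theorem colorful_quantitative_helly_volume
    (d : ℕ) (hd : 0 < d) (ε : ℝ) (hε : 0 < ε) :
    ∃ n : ℕ, 0 < n ∧
      ∀ F : Fin n → Finset (Set (EuclideanSpace ℝ (Fin d))),
        (∀ i, (F i).Nonempty) →
        (∀ i, ∀ K ∈ F i, Convex ℝ K) →
        (∀ K : Fin n → Set (EuclideanSpace ℝ (Fin d)), (∀ i, K i ∈ F i) →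
          1 ≤ volume (⋂ i, K i)) →
        ∃ i : Fin n,
          ENNReal.ofReal (1 / (1 + ε)) ≤
            volume (⋂₀ ((F i : Finset (Set (EuclideanSpace ℝ (Fin d)))) :
              Set (Set (EuclideanSpace ℝ (Fin d))))) := by
  classical
  obtain ⟨N, M, hM, hbase⟩ := exists_one_le_volume_iInter_of_rainbow hd
  have hd' : (0 : ℝ) < d := by exact_mod_cast hd
  set s : ℝ := ε / ((1 + ε) * d) with hs
  have hspos : 0 < s := by positivity
  have hs1 : s < 1 := by
    rw [hs, div_lt_one (by positivity)]
    have : (1 : ℝ) ≤ d := by exact_mod_cast hd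
    nlinarith
  have hpow : 1 / (1 + ε) ≤ (1 - s) ^ d := by
    calc 1 / (1 + ε) = 1 + d * -s := by rw [hs]; field_simp; ring
      _ ≤ (1 + -s) ^ d := one_add_mul_le_pow (by linarith) d
      _ = (1 - s) ^ d := by rw [sub_eq_add_neg]
  set q : ℝ := 1 - s ^ d / (d + 1 : ℕ) with hq
  have hfrac : s ^ d / (d + 1 : ℕ) ≤ 1 := by
    rw [div_le_one (by positivity)]
    exact (pow_le_one₀ hspos.le hs1.le).trans (by simp)
  have hq0 : 0 ≤ q := by linarith
  have hq1 : q < 1 := by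
    have : 0 < s ^ d / (d + 1 : ℕ) := by positivity
    linarith
  obtain ⟨m, hm⟩ := exists_pow_lt_of_lt_one (inv_pos.2 hM) hq1
  have hlt1 : M * q ^ m < 1 := by
    calc M * q ^ m < M * M⁻¹ := by gcongr
      _ = 1 := mul_inv_cancel₀ hM.ne'
  refine ⟨N + m + 1, by omega, fun F hne hconv hvol => ?_⟩
  by_contra! hsmall
  have hsub : ∀ i, volume (⋂ k : F i, (k : Set (EuclideanSpace ℝ (Fin d)))) <
      ENNReal.ofReal (1 / (1 + ε)) := by
    intro i
    have := hsmall i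
    rwa [Set.sInter_eq_iInter] at this
  have key : ∀ j ≤ m, ∃ K : Fin (N + m + 1) → Set (EuclideanSpace ℝ (Fin d)), (∀ i, K i ∈ F i) ∧
      volume (⋂ (i : Fin (N + m + 1)) (_ : (i : ℕ) < N + j), K i) ≤ ENNReal.ofReal (M * q ^ j) := by
    intro j
    induction j with
    | zero =>
      intro _
      let g : Fin N → Fin (N + m + 1) := Fin.castLE (by omega)
      have : ∀ i, Nonempty (F (g i)) := fun i => (hne (g i)).to_subtype
      have hx : ∃ x : ∀ i, F (g i), volume (⋂ i, (x i : Set (EuclideanSpace ℝ (Fin d)))) ≤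
          ENNReal.ofReal M := by
        by_contra! hno
        obtain ⟨i, hi⟩ := hbase (fun i => F (g i)) (fun i k => k.1)
          (fun i k => hconv _ _ k.2) hno
        have h1 : ENNReal.ofReal (1 / (1 + ε)) ≤ 1 := by
          rw [ENNReal.ofReal_le_one, div_le_one (by positivity)]
          linarith
        exact ((hsub (g i)).trans_le h1).not_ge hi
      obtain ⟨x, hx⟩ := hx
      choose K₀ hK₀ using hne
      refine ⟨fun i => if h : (i : ℕ) < N then x ⟨i, h⟩ else K₀ i, fun i => ?_, ?_⟩
      · by_cases h : (i : ℕ) < N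
        · simp [h]
        · simpa [h] using hK₀ i
      · rw [pow_zero, mul_one]
        refine (measure_mono fun y hy => Set.mem_iInter.2 fun i => ?_).trans hx
        have := Set.mem_iInter₂.1 hy (g i) (by simp [g])
        simpa [g] using this
    | succ j ih =>
      intro hj
      obtain ⟨K, hKF, hKle⟩ := ih (by omega)
      set C := ⋂ (i : Fin (N + m + 1)) (_ : (i : ℕ) < N + j), K i with hC
      have hCc : Convex ℝ C := convex_iInter₂ fun i _ => hconv i _ (hKF i)
      have hCtop : volume C ≠ ⊤ := ne_top_of_le_ne_top ENNReal.ofReal_ne_top hKle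
      have hC1 : 1 ≤ volume C := (hvol K hKF).trans <| measure_mono fun y hy =>
        Set.mem_iInter₂.2 fun i _ => Set.mem_iInter.1 hy i
      let i₀ : Fin (N + m + 1) := ⟨N + j, by omega⟩
      obtain ⟨k, hk⟩ := exists_measure_inter_le_of_measure_iInter_lt volume hCc hCtop hspos hs1
        (K := fun k : F i₀ => (k : Set (EuclideanSpace ℝ (Fin d)))) (fun k => hconv _ _ k.2) (by
          refine (hsub i₀).trans_le ?_
          rw [finrank_euclideanSpace_fin]
          exact (ENNReal.ofReal_le_ofReal hpow).trans (le_mul_of_one_le_right' hC1))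
      rw [finrank_euclideanSpace_fin, ← hq] at hk
      refine ⟨Function.update K i₀ k, fun i => ?_, ?_⟩
      · rcases eq_or_ne i i₀ with rfl | h
        · simp
        · simpa [Function.update_of_ne h] using hKF i
      · calc _ ≤ volume (C ∩ k) := by
              refine measure_mono fun y hy => ⟨Set.mem_iInter₂.2 fun i hi => ?_, ?_⟩
              · have h : i ≠ i₀ := fun h => by simp [h, i₀] at hi
                have := Set.mem_iInter₂.1 hy i (by omega)
                rwa [Function.update_of_ne h] at this
              · simpa using Set.mem_iInter₂.1 hy i₀ (by simp [i₀])
          _ ≤ ENNReal.ofReal q * volume C := hk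
          _ ≤ ENNReal.ofReal q * ENNReal.ofReal (M * q ^ j) := by gcongr
          _ = ENNReal.ofReal (M * q ^ (j + 1)) := by
              rw [← ENNReal.ofReal_mul hq0]
              congr 1
              ring
  obtain ⟨K, hKF, hKle⟩ := key m le_rfl
  have h1 : 1 ≤ ENNReal.ofReal (M * q ^ m) := ((hvol K hKF).trans <| measure_mono fun y hy =>
    Set.mem_iInter₂.2 fun i _ => Set.mem_iInter.1 hy i).trans hKle
  rw [ENNReal.one_le_ofReal] at h1
  linarith
end

section
/- Let d and m be positive integers and set n = (2dm − 1)(d + 1) + 1. Let T_1, T_2, …, T_n be subsets of ℝ^d such that for each i there exists c_i ∈ ℝ^d with B_1(c_i) ⊆ conv(T_i). Then one can choose points t_1 ∈ T_1, t_2 ∈ T_2, …, t_n ∈ T_n and a partition of {t_1, t_2, …, t_n} into m sets A_1, A_2, …, A_m such that the intersection ⋂_{i=1}^m conv(A_i) contains a Euclidean ball of radius (π/e²)·d^{−2d−2}, i.e., there exists p ∈ ℝ^d with B_r(p) ⊆ ⋂_{i=1}^m conv(A_i) for r = (π/e²)·d^{−2d−2}. -/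
section Tools

open Finset

/-- Moving from a nonnegative vector in a direction with a negative coordinate, one first meets
the boundary of the orthant. -/
lemma exists_ratio_step {ι : Type*} [Fintype ι] {l g : ι → ℝ} (hl : ∀ i, 0 ≤ l i)
    (hg : ∃ i, g i < 0) :
    ∃ θ : ℝ, 0 ≤ θ ∧ (∃ i, g i < 0 ∧ l i + θ * g i = 0) ∧ ∀ i, 0 ≤ l i + θ * g i := by
  classical
  obtain ⟨i₀, hi₀⟩ := hg
  obtain ⟨i, hi, hmin⟩ := (univ.filter fun i => g i < 0).exists_min_image
    (fun i => l i / -g i) ⟨i₀, by simpa using hi₀⟩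
  simp only [mem_filter, mem_univ, true_and] at hi hmin
  refine ⟨l i / -g i, div_nonneg (hl i) (by linarith), ⟨i, hi, ?_⟩, fun j => ?_⟩
  · have : g i ≠ 0 := hi.ne
    field_simp
    ring
  · rcases lt_or_ge (g j) 0 with hj | hj
    · have h := hmin j hj
      rw [le_div_iff₀ (by linarith)] at h
      linarith
    · have : 0 ≤ l i / -g i := div_nonneg (hl i) (by linarith)
      have := mul_nonneg this hj
      linarith [hl j]

/-- A linearly dependent finite family has a linear relation with a negative coefficient. -/
lemma exists_neg_relation {ι E : Type*} [Fintype ι] [AddCommGroup E] [Module ℝ E] {v : ι → E}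
    (h : ¬ LinearIndependent ℝ v) : ∃ g : ι → ℝ, ∑ i, g i • v i = 0 ∧ ∃ i, g i < 0 := by
  rw [Fintype.not_linearIndependent_iff] at h
  obtain ⟨g, hg, i, hi⟩ := h
  rcases lt_or_gt_of_ne hi with h | h
  · exact ⟨g, hg, i, h⟩
  · exact ⟨fun i => -g i, by simp [hg], i, by simpa using h⟩

section Cone

variable {E : Type*} [NormedAddCommGroup E] [InnerProductSpace ℝ E]

/-- A small step along `x` decreases the norm of `n - x` if `x` and `n` make an acute angle. -/
lemma exists_closer {n x : E} (h : 0 < inner ℝ n x) : ∃ ε : ℝ, 0 < ε ∧ ∀ δ, 0 < δ → δ ≤ ε →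
    ‖n - δ • x‖ < ‖n‖ := by
  have hx : 0 < ‖x‖ ^ 2 := by
    have : x ≠ 0 := by rintro rfl; simp at h
    positivity
  refine ⟨inner ℝ n x / ‖x‖ ^ 2, by positivity, fun δ h0 hδ => ?_⟩
  rw [le_div_iff₀ hx] at hδ
  have : ‖n - δ • x‖ ^ 2 < ‖n‖ ^ 2 := by
    rw [norm_sub_sq_real, inner_smul_right, norm_smul, mul_pow, Real.norm_eq_abs, sq_abs]
    nlinarith
  exact lt_of_pow_lt_pow_left₀ 2 (norm_nonneg _) this

lemma isClosed_cone_fin : ∀ (n : ℕ) (v : Fin n → E),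
    IsClosed {w : E | ∃ l : Fin n → ℝ, (∀ i, 0 ≤ l i) ∧ ∑ i, l i • v i = w} := by
  intro n
  induction n with
  | zero =>
    intro v
    convert isClosed_singleton (x := (0 : E)) using 1
    ext w
    simp [eq_comm]
  | succ n ih =>
    intro v
    by_cases hv : LinearIndependent ℝ v
    · have hinj : LinearMap.ker (Fintype.linearCombination ℝ v) = ⊥ :=
        LinearMap.ker_eq_bot.2 hv.fintypeLinearCombination_injective
      have hemb := LinearMap.isClosedEmbedding_of_injective hinj
      have hcl : IsClosed {l : Fin (n + 1) → ℝ | ∀ i, 0 ≤ l i} := by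
        simp only [Set.ofPred_forall]
        exact isClosed_iInter fun i => isClosed_le continuous_const (continuous_apply i)
      convert hemb.isClosedMap _ hcl using 1
      ext w
      simp [Fintype.linearCombination_apply]
    · obtain ⟨g, hg, hneg⟩ := exists_neg_relation hv
      have hU : {w : E | ∃ l : Fin (n + 1) → ℝ, (∀ i, 0 ≤ l i) ∧ ∑ i, l i • v i = w} =
          ⋃ i : Fin (n + 1), {w : E | ∃ l : Fin n → ℝ, (∀ j, 0 ≤ l j) ∧
            ∑ j, l j • v (i.succAbove j) = w} := by
        ext w
        simp only [Set.mem_ofPred_eq, Set.mem_iUnion]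
        constructor
        · rintro ⟨l, hl, rfl⟩
          obtain ⟨θ, -, ⟨i, -, hi⟩, hpos⟩ := exists_ratio_step hl hneg
          refine ⟨i, fun j => l (i.succAbove j) + θ * g (i.succAbove j), fun j => hpos _, ?_⟩
          have h1 : ∑ k, (l k + θ * g k) • v k = ∑ k, l k • v k := by
            simp only [add_smul, mul_smul, sum_add_distrib, ← smul_sum, hg, smul_zero, add_zero]
          rw [← h1, Fin.sum_univ_succAbove _ i, hi, zero_smul, zero_add]
        · rintro ⟨i, l, hl, rfl⟩
          refine ⟨i.insertNth 0 l, fun j => ?_, ?_⟩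
          · induction j using Fin.succAboveCases i <;> simp [hl]
          · rw [Fin.sum_univ_succAbove _ i]
            simp
      rw [hU]
      exact isClosed_iUnion_of_finite fun i => ih _

/-- Finitely generated cones are closed. -/
lemma isClosed_cone {ι : Type*} [Fintype ι] (v : ι → E) :
    IsClosed {w : E | ∃ l : ι → ℝ, (∀ i, 0 ≤ l i) ∧ ∑ i, l i • v i = w} := by
  let e := Fintype.equivFin ι
  convert isClosed_cone_fin (Fintype.card ι) (v ∘ e.symm) using 1
  ext w
  constructor
  · rintro ⟨l, hl, rfl⟩
    exact ⟨l ∘ e.symm, fun i => hl _, e.symm.sum_comp fun i => l i • v i⟩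
  · rintro ⟨l, hl, rfl⟩
    refine ⟨l ∘ e, fun i => hl _, ?_⟩
    rw [← e.sum_comp]
    simp

variable [FiniteDimensional ℝ E]

/-- Nearest point of a finitely generated cone. -/
lemma exists_nearest_in_cone {ι : Type*} [Fintype ι] (v : ι → E) (a : E) :
    ∃ l : ι → ℝ, (∀ i, 0 ≤ l i) ∧
      (∀ m : ι → ℝ, (∀ i, 0 ≤ m i) → ‖a - ∑ i, l i • v i‖ ≤ ‖a - ∑ i, m i • v i‖) := by
  obtain ⟨z, ⟨l, hl, rfl⟩, hz⟩ := (isClosed_cone v).exists_infDist_eq_dist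
    ⟨0, fun _ => 0, fun _ => le_rfl, by simp⟩ a
  refine ⟨l, hl, fun m hm => ?_⟩
  rw [← dist_eq_norm, ← dist_eq_norm, ← hz]
  exact Metric.infDist_le_dist_of_mem ⟨m, hm, rfl⟩

/-- Conic colourful Carathéodory theorem. -/
theorem colorful_caratheodory_cone_s11 {J K : Type*} [Fintype J] [Fintype K] [Nonempty K]
    (hJ : Module.finrank ℝ E ≤ Fintype.card J) (y : J → K → E) (a : E)
    (ha : ∀ j (n : E), 0 < inner ℝ n a → ∃ k, 0 < inner ℝ n (y j k)) :
    ∃ (k : J → K) (l : J → ℝ), (∀ j, 0 ≤ l j) ∧ ∑ j, l j • y j (k j) = a := by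
  classical
  choose L hL0 hLmin using fun k : J → K => exists_nearest_in_cone (fun j => y j (k j)) a
  obtain ⟨k, hk⟩ := Finite.exists_min fun k : J → K => ‖a - ∑ j, L k j • y j (k j)‖
  refine ⟨k, L k, hL0 k, ?_⟩
  set n : E := a - ∑ j, L k j • y j (k j) with hn
  by_contra hne
  have hn0 : n ≠ 0 := fun h => hne (sub_eq_zero.1 (hn.symm.trans h)).symm
  have key : ∀ (k' : J → K) (m : J → ℝ), (∀ j, 0 ≤ m j) →
      ‖n‖ ≤ ‖a - ∑ j, m j • y j (k' j)‖ := fun k' m hm => (hk k').trans (hLmin k' m hm)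
  have upd : ∀ (m : J → ℝ) (i : J) (δ : ℝ), ∑ j, (m j + if j = i then δ else 0) • y j (k j) =
      ∑ j, m j • y j (k j) + δ • y i (k i) := by
    intro m i δ
    simp [add_smul, sum_add_distrib, ite_smul]
  have hle : ∀ i, inner ℝ n (y i (k i)) ≤ 0 := by
    intro i
    by_contra! h
    obtain ⟨ε, hε, hc⟩ := exists_closer h
    have h1 := key k (fun j => L k j + if j = i then ε else 0) (fun j => by
      have := hL0 k j
      split_ifs <;> linarith)
    rw [upd, ← sub_sub, ← hn] at h1
    exact absurd (hc ε hε le_rfl) (not_lt.2 h1)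
  have heq : ∀ i, 0 < L k i → inner ℝ n (y i (k i)) = 0 := by
    intro i hi
    by_contra! h
    have h2 : 0 < inner ℝ n (-y i (k i)) := by
      rw [inner_neg_right]
      exact neg_pos.2 (lt_of_le_of_ne (hle i) h)
    obtain ⟨ε, hε, hc⟩ := exists_closer h2
    have h1 := key k (fun j => L k j + if j = i then -(min ε (L k i)) else 0) (fun j => by
      have := hL0 k j
      split_ifs with hji
      · subst hji; linarith [min_le_right ε (L k j)]
      · linarith)
    rw [upd, ← sub_sub, ← hn, neg_smul, ← smul_neg] at h1
    exact absurd (hc _ (lt_min hε hi) (min_le_left _ _)) (not_lt.2 h1)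
  have hsum : inner ℝ n (∑ j, L k j • y j (k j)) = 0 := by
    rw [inner_sum]
    refine sum_eq_zero fun i _ => ?_
    rw [inner_smul_right]
    rcases (hL0 k i).eq_or_lt with h | h
    · simp [← h]
    · simp [heq i h]
  have hna : 0 < inner ℝ n a := by
    have : a = n + ∑ j, L k j • y j (k j) := by simp [hn]
    rw [this, inner_add_right, hsum, add_zero, real_inner_self_eq_norm_sq]
    positivity
  obtain ⟨m, i, hm0, hmi, hm⟩ : ∃ (m : J → ℝ) (i : J), (∀ j, 0 ≤ m j) ∧ m i = 0 ∧
      ∑ j, m j • y j (k j) = ∑ j, L k j • y j (k j) := by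
    by_cases hz : ∃ i, L k i = 0
    · obtain ⟨i, hi⟩ := hz
      exact ⟨L k, i, hL0 k, hi, rfl⟩
    · push Not at hz
      have hdep : ¬ LinearIndependent ℝ fun j => y j (k j) := by
        intro hli
        have hspan := hli.span_eq_top_of_card_eq_finrank'
          (le_antisymm hli.fintype_card_le_finrank hJ)
        have : n ∈ (ℝ ∙ n)ᗮ := by
          have hsub : Submodule.span ℝ (Set.range fun j => y j (k j)) ≤ (ℝ ∙ n)ᗮ := by
            rw [Submodule.span_le]
            rintro _ ⟨j, rfl⟩
            rw [SetLike.mem_coe, Submodule.mem_orthogonal_singleton_iff_inner_right]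
            exact heq j (lt_of_le_of_ne (hL0 k j) (hz j).symm)
          exact hsub (hspan ▸ Submodule.mem_top)
        rw [Submodule.mem_orthogonal_singleton_iff_inner_right] at this
        exact hn0 (inner_self_eq_zero.1 this)
      obtain ⟨g, hg, hneg⟩ := exists_neg_relation hdep
      obtain ⟨θ, -, ⟨i, -, hi⟩, hpos⟩ := exists_ratio_step (hL0 k) hneg
      refine ⟨fun j => L k j + θ * g j, i, hpos, hi, ?_⟩
      simp only [add_smul, mul_smul, sum_add_distrib, ← smul_sum, hg, smul_zero, add_zero]
  obtain ⟨k₁, hk₁⟩ := ha i n hna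
  obtain ⟨ε, hε, hc⟩ := exists_closer hk₁
  have h1 := key (Function.update k i k₁) (fun j => m j + if j = i then ε else 0) (fun j => by
    have := hm0 j
    split_ifs <;> linarith)
  have h2 : ∑ j, (m j + if j = i then ε else 0) • y j (Function.update k i k₁ j) =
      ∑ j, L k j • y j (k j) + ε • y i k₁ := by
    rw [← hm]
    simp only [add_smul, sum_add_distrib]
    congr 1
    · refine sum_congr rfl fun j _ => ?_
      by_cases hj : j = i
      · subst hj; simp [hmi]
      · rw [Function.update_of_ne hj]
    · simp [ite_smul]
  rw [h2, ← sub_sub, ← hn] at h1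
  exact absurd (hc ε hε le_rfl) (not_lt.2 h1)

end Cone

/-- Tverberg's theorem, with parts indexed by `Option Q`, stated through convex combinations. -/
theorem tverberg {J Q D : Type*} [Fintype J] [Fintype Q] [Fintype D] [DecidableEq Q]
    (hJ : Fintype.card J = Fintype.card Q * (Fintype.card D + 1) + 1)
    (c : J → EuclideanSpace ℝ D) :
    ∃ (k : J → Option Q) (l : J → ℝ) (p : EuclideanSpace ℝ D), (∀ j, 0 ≤ l j) ∧
      ∀ r, ∑ j with k j = r, l j = 1 ∧ ∑ j with k j = r, l j • c j = p := by
  classical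
  let h : J → Option D → ℝ := fun j s => s.elim 1 (fun i => c j i)
  let v : Option Q → Q → ℝ := fun k q =>
    (if k = some q then 1 else 0) - (if k = none then 1 else 0)
  let y : J → Option Q → EuclideanSpace ℝ (Option (Q × Option D)) := fun j k =>
    WithLp.toLp 2 fun o => o.elim 1 (fun qs => h j qs.2 * v k qs.1)
  let a : EuclideanSpace ℝ (Option (Q × Option D)) :=
    EuclideanSpace.single none (Fintype.card (Option Q) : ℝ)
  have hv : ∀ q, ∑ k, v k q = 0 := fun q => by simp [v]
  have hya : ∀ j, ∑ k, y j k = a := by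
    intro j
    ext o
    rw [WithLp.ofLp_sum, Finset.sum_apply]
    rcases o with _ | ⟨q, s⟩
    · simp [y, a]
    · simp [y, a, ← mul_sum, hv]
  obtain ⟨k, l, hl, hsum⟩ := colorful_caratheodory_cone_s11 (E := EuclideanSpace ℝ _)
    (by simp [hJ]) y a (fun j n hn => by
      by_contra! hk
      rw [← hya j, inner_sum] at hn
      exact absurd hn (not_lt.2 (sum_nonpos fun k _ => hk k)))
  have hcoord : ∀ o, ∑ j, l j * y j (k j) o = a o := by
    intro o
    rw [← hsum, WithLp.ofLp_sum, Finset.sum_apply]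
    simp
  have hmass : ∀ q s, ∑ j with k j = some q, l j * h j s = ∑ j with k j = none, l j * h j s := by
    intro q s
    have := hcoord (some (q, s))
    rw [sum_filter, sum_filter, ← sub_eq_zero, ← sum_sub_distrib]
    simp only [a, y, Option.elim_some, v] at this
    rw [show (EuclideanSpace.single none (Fintype.card (Option Q) : ℝ) :
      EuclideanSpace ℝ (Option (Q × Option D))) (some (q, s)) = 0 by simp] at this
    refine Eq.trans (sum_congr rfl fun j _ => ?_) this
    rcases hk : k j with _ | q'
    · simp
    · by_cases hq : q' = q <;> simp [hq]
  have hall : ∀ r s, ∑ j with k j = r, l j * h j s = ∑ j with k j = none, l j * h j s := by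
    rintro (_ | q) s
    exacts [rfl, hmass q s]
  have htot : ∑ r, ∑ j with k j = r, l j * h j none = Fintype.card (Option Q) := by
    rw [sum_fiberwise]
    simpa [a, y, h] using hcoord none
  have hone : ∑ j with k j = none, l j * h j none = 1 := by
    simp only [fun r => hall r none, sum_const, card_univ, nsmul_eq_mul] at htot
    have : (Fintype.card (Option Q) : ℝ) ≠ 0 := by simp; positivity
    exact mul_left_cancel₀ this (by rw [htot, mul_one])
  refine ⟨k, l, ∑ j with k j = none, l j • c j, hl, fun r => ⟨?_, ?_⟩⟩
  · simpa [h] using (hall r none).trans hone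
  · ext i
    have := hall r (some i)
    rw [WithLp.ofLp_sum, WithLp.ofLp_sum, Finset.sum_apply, Finset.sum_apply]
    simpa [h] using this

section Octahedron

variable {E : Type*} [AddCommGroup E] [Module ℝ E]

/-- `a` lies in the cone generated by the `y k` with `k ≠ i`. -/
def MemConeOmitting {κ : Type*} [Fintype κ] (y : κ → E) (a : E) (i : κ) : Prop :=
  ∃ l : κ → ℝ, (∀ k, 0 ≤ l k) ∧ l i = 0 ∧ ∑ k, l k • y k = a

/-- If `y` has more elements than the dimension and lies in an open half-space, then a generic `a`
lies in an even number of the facet cones of `y`. -/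
lemma even_card_memConeOmitting [FiniteDimensional ℝ E] {κ : Type*} [Fintype κ] (y : κ → E) (a : E)
    (hcard : Module.finrank ℝ E < Fintype.card κ) (f : E →ₗ[ℝ] ℝ) (hf : ∀ k, 0 < f (y k))
    (hgen : ∀ l : κ → ℝ, (∀ k, 0 ≤ l k) → ∑ k, l k • y k = a →
      ∀ i i', l i = 0 → l i' = 0 → i = i') [DecidablePred (MemConeOmitting y a)] :
    Even (univ.filter fun i => MemConeOmitting y a i).card := by
  classical
  have hneg : ∀ g : κ → ℝ, ∑ k, g k • y k = 0 → g ≠ 0 → ∃ k, g k < 0 := by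
    intro g hg hne
    by_contra! hpos
    have h0 : ∑ k, g k * f (y k) = 0 := by
      have := congrArg f hg
      simpa using this
    rw [sum_eq_zero_iff_of_nonneg fun k _ => mul_nonneg (hpos k) (hf k).le] at h0
    exact hne (funext fun k =>
      (mul_eq_zero.1 (h0 k (mem_univ k))).resolve_right (hf k).ne')
  have hshift : ∀ (l g : κ → ℝ) (θ : ℝ), ∑ k, l k • y k = a → ∑ k, g k • y k = 0 →
      ∑ k, (l k + θ * g k) • y k = a := by
    intro l g θ h1 h2
    simp only [add_smul, mul_smul, sum_add_distrib, ← smul_sum, h1, h2, smul_zero, add_zero]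
  have hzero : ∀ (l g : κ → ℝ) (i : κ), (∀ k, 0 ≤ l k) → l i = 0 → ∑ k, l k • y k = a → g i = 0 →
      ∑ k, g k • y k = 0 → g = 0 := by
    intro l g i hl hli hla hgi hg
    by_contra hne
    obtain ⟨θ, -, ⟨i', hi', hi'0⟩, hpos⟩ := exists_ratio_step hl (hneg g hg hne)
    have := hgen _ hpos (hshift l g θ hla hg) i i' (by simp [hli, hgi]) hi'0
    rw [← this, hgi] at hi'
    exact lt_irrefl _ hi'
  rcases (univ.filter fun i => MemConeOmitting y a i).eq_empty_or_nonempty with he | ⟨q, hq⟩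
  · rw [he]
    simp
  obtain ⟨l, hl, hlq, hla⟩ := (mem_filter.1 hq).2
  obtain ⟨g, hg, hgq⟩ : ∃ g : κ → ℝ, ∑ k, g k • y k = 0 ∧ 0 < g q := by
    obtain ⟨g, hg, i, hi⟩ := exists_neg_relation (v := y) fun h =>
      absurd h.fintype_card_le_finrank (not_le.2 hcard)
    rcases lt_trichotomy (g q) 0 with h | h | h
    · exact ⟨fun k => -g k, by simp [hg], by simpa using h⟩
    · have := hzero l g q hl hlq hla h hg
      simp [this] at hi
    · exact ⟨g, hg, h⟩
  obtain ⟨θ, hθ, ⟨q', hq', hq'0⟩, hpos⟩ := exists_ratio_step hl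
    (hneg g hg fun h => by simp [h] at hgq)
  have hqq' : q ≠ q' := by
    rintro rfl
    exact lt_asymm hgq hq'
  have hθ' : 0 < θ := by
    refine hθ.lt_of_ne ?_
    rintro rfl
    exact hqq' (hgen l hl hla q q' hlq (by simpa using hq'0))
  have : (univ.filter fun i => MemConeOmitting y a i) = {q, q'} := by
    ext i
    simp only [mem_filter, mem_univ, true_and, mem_insert, mem_singleton]
    constructor
    · rintro ⟨m, hm, hmi, hma⟩
      by_contra! hi
      have hmq : 0 < m q := (hm q).lt_of_ne fun h => hi.1 (hgen m hm hma i q hmi h.symm)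
      have hmq' : 0 < m q' := (hm q').lt_of_ne fun h => hi.2 (hgen m hm hma i q' hmi h.symm)
      have hli : 0 < l i := (hl i).lt_of_ne fun h => hi.1 (hgen l hl hla i q h.symm hlq)
      have hgi : 0 < l i + θ * g i :=
        (hpos i).lt_of_ne fun h => hi.2 (hgen _ hpos (hshift l g θ hla hg) i q' h.symm hq'0)
      have h0 := hzero l (fun k => g q * (m k - l k) - m q * g k) q hl hlq hla
        (by simp [hlq]; ring) (by
          simp only [sub_smul, mul_smul, sum_sub_distrib, ← smul_sum, hg, hma, hla]
          simp)
      have h1 := congrFun h0 i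
      have h2 := congrFun h0 q'
      simp only [hmi, Pi.zero_apply] at h1 h2
      have h3 : g i < 0 := by
        by_contra! h
        nlinarith [mul_nonneg hmq.le h, mul_pos hgq hli]
      have e1 : m q * g i = -(g q * l i) := by linarith
      have e2 : m q * g q' = g q * (m q' - l q') := by linarith
      have e3 : l q' = -(θ * g q') := by linarith
      -- the parameter of `m` on the line is `s = m q / g q`, with `s < θ` and `s > θ`
      have e4 : g q * m q' = (g q * θ - m q) * (-g q') := by
        rw [e3] at e2
        linarith
      have s1 : 0 < g q * θ - m q := by
        have := mul_pos hgq hmq'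
        rw [e4] at this
        exact pos_of_mul_pos_left this (by linarith)
      have e5 : g q * (l i + θ * g i) = (g q * θ - m q) * g i := by linarith
      have := mul_pos hgq hgi
      rw [e5] at this
      nlinarith [mul_pos s1 (neg_pos.2 h3)]
    · rintro (rfl | rfl)
      · exact ⟨l, hl, hlq, hla⟩
      · exact ⟨_, hpos, hq'0, hshift l g θ hla hg⟩
  rw [this, card_pair hqq']
  exact even_two

/-- Octahedron lemma: for a colour class pair `p₀` and pairs `p j`, the number of rainbow cones
containing a generic point is even. The rainbow selection `(b, τ)` uses `p₀ (!b)`. -/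
lemma octahedron [FiniteDimensional ℝ E] {J : Type*} [Fintype J] [DecidableEq J]
    (p₀ : Bool → E) (p : J → Bool → E) (a : E) (hcard : Module.finrank ℝ E = Fintype.card J + 1)
    (f : E →ₗ[ℝ] ℝ) (hf₀ : ∀ b, 0 < f (p₀ b)) (hf : ∀ j b, 0 < f (p j b))
    (hgen : ∀ (τ : J → Bool) (l : Bool ⊕ J → ℝ), (∀ k, 0 ≤ l k) →
      ∑ k, l k • Sum.elim p₀ (fun j => p j (τ j)) k = a → ∀ i i', l i = 0 → l i' = 0 → i = i')
    (b₀ : Bool) (τ₀ : J → Bool)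
    (h₀ : MemConeOmitting (Sum.elim p₀ fun j => p j (τ₀ j)) a (.inl b₀)) :
    ∃ b τ, (b, τ) ≠ (b₀, τ₀) ∧ MemConeOmitting (Sum.elim p₀ fun j => p j (τ j)) a (.inl b) := by
  classical
  let G : (J → Bool) → Bool ⊕ J → Prop := fun τ i =>
    MemConeOmitting (Sum.elim p₀ fun j => p j (τ j)) a i
  have heven : ∀ τ, ∑ i, (if G τ i then (1 : ZMod 2) else 0) = 0 := by
    intro τ
    rw [← sum_filter, sum_const, nsmul_one, ZMod.natCast_eq_zero_iff_even]
    refine even_card_memConeOmitting _ a ?_ f ?_ (hgen τ)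
    · simp [hcard]
      omega
    · rintro (b | j)
      exacts [hf₀ b, hf j _]
  have hinr : ∀ j, ∑ τ, (if G τ (.inr j) then (1 : ZMod 2) else 0) = 0 := by
    intro j
    have hG : ∀ τ b, G τ (.inr j) → G (Function.update τ j b) (.inr j) := by
      rintro τ b ⟨l, hl, hlj, hla⟩
      refine ⟨l, hl, hlj, ?_⟩
      rw [← hla]
      refine sum_congr rfl fun k _ => ?_
      rcases k with b' | i
      · rfl
      · by_cases hi : i = j
        · subst hi; simp [hlj]
        · simp [hi]
    have hup : ∀ τ : J → Bool, Function.update (Function.update τ j (!τ j)) j (τ j) = τ := by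
      intro τ; simp
    refine sum_involution (fun τ _ => Function.update τ j (!τ j)) ?_ ?_ ?_ ?_
    · intro τ _
      have : G (Function.update τ j (!τ j)) (.inr j) ↔ G τ (.inr j) :=
        ⟨fun h => by simpa only [hup] using hG _ (τ j) h, hG τ _⟩
      simp only [this]
      exact CharTwo.add_self_eq_zero _
    · intro τ _ _ h
      have := congrFun h j
      simp at this
    · intro τ _
      exact mem_univ _
    · intro τ _
      simp
  have htot : ∑ x : (J → Bool) × Bool, (if G x.1 (.inl x.2) then (1 : ZMod 2) else 0) = 0 := by
    have h1 : ∑ τ, ∑ i, (if G τ i then (1 : ZMod 2) else 0) = 0 := by simp [heven]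
    simp only [Fintype.sum_sum_type, sum_add_distrib] at h1
    have h2 : ∑ τ, ∑ j, (if G τ (.inr j) then (1 : ZMod 2) else 0) = 0 := by
      rw [sum_comm]
      exact sum_eq_zero fun j _ => hinr j
    rw [h2, add_zero] at h1
    rw [Fintype.sum_prod_type]
    exact h1
  rw [← sum_filter, sum_const, nsmul_one, ZMod.natCast_eq_zero_iff_even] at htot
  have hmem : (τ₀, b₀) ∈ univ.filter fun x : (J → Bool) × Bool => G x.1 (.inl x.2) := by
    simpa [G] using h₀
  have hlt : 1 < (univ.filter fun x : (J → Bool) × Bool => G x.1 (.inl x.2)).card := by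
    have := card_pos.2 ⟨_, hmem⟩
    obtain ⟨r, hr⟩ := htot
    omega
  obtain ⟨⟨τ, b⟩, hx, hne⟩ := exists_mem_ne hlt (τ₀, b₀)
  refine ⟨b, τ, fun h => hne ?_, by simpa [G] using hx⟩
  simp only [Prod.mk.injEq] at h ⊢
  exact ⟨h.2, h.1⟩

end Octahedron

section Ray

variable {E : Type*} [NormedAddCommGroup E] [InnerProductSpace ℝ E]

lemma sum_smul_mem_span_of_two_zeros {κ S : Type*} [Fintype κ] [DecidableEq κ] [DecidableEq S]
    {e : ℕ} (hκ : Fintype.card κ ≤ e + 2) (y : S → E) (a : E)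
    (hgen : ∀ T : Finset S, T.card ≤ e → a ∉ Submodule.span ℝ (y '' (T : Set S)))
    (s : κ → S) (l : κ → ℝ) (hl : ∑ k, l k • y (s k) = a) (i i' : κ) (hi : l i = 0)
    (hi' : l i' = 0) : i = i' := by
  by_contra hne
  refine hgen (((univ.erase i).erase i').image s) (card_image_le.trans ?_) ?_
  · rw [card_erase_of_mem (by simp [Ne.symm hne]), card_erase_of_mem (mem_univ _), card_univ]
    omega
  · rw [← hl]
    refine Submodule.sum_mem _ fun k _ => ?_
    by_cases hk : k = i
    · simp [hk, hi]
    by_cases hk' : k = i'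
    · simp [hk', hi']
    exact Submodule.smul_mem _ _ (Submodule.subset_span
      ⟨s k, by simpa using ⟨k, ⟨hk, hk'⟩, rfl⟩, rfl⟩)

/-- A family of `e + 1` vectors spanning `a`, no `e` of which span `a`, is independent. -/
lemma linearIndependent_of_generic {e : ℕ} (x : Fin (e + 1) → E) (a : E) (l : Fin (e + 1) → ℝ)
    (hl : ∑ j, l j • x j = a)
    (hgen : ∀ i : Fin (e + 1), a ∉ Submodule.span ℝ (Set.range fun j : Fin e => x (i.succAbove j))) :
    LinearIndependent ℝ x := by
  rw [linearIndependent_iff_notMem_span]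
  intro i hi
  refine hgen i ?_
  have hset : x '' (Set.univ \ {i}) = Set.range fun j : Fin e => x (i.succAbove j) := by
    rw [← Set.compl_eq_univ_sdiff, ← Fin.range_succAbove, ← Set.range_comp]
    rfl
  rw [hset] at hi
  rw [← hl, Fin.sum_univ_succAbove _ i]
  exact Submodule.add_mem _ (Submodule.smul_mem _ _ hi) (Submodule.sum_mem _ fun j _ =>
    Submodule.smul_mem _ _ (Submodule.subset_span ⟨j, rfl⟩))

variable [FiniteDimensional ℝ E]

/-- Rainbow facet beyond `a`: if every colour class has `a` in its convex hull, then for generic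
`a` there is a rainbow simplex meeting the ray through `a` at `a` or beyond. -/
theorem exists_rainbow_beyond {e : ℕ} {K : Type*} [Fintype K] [Nonempty K]
    (hE : Module.finrank ℝ E = e + 1) (y : Fin (e + 1) → K → E) (a : E)
    (hgen : ∀ T : Finset (Fin (e + 1) × K), T.card ≤ e →
      a ∉ Submodule.span ℝ ((fun s => y s.1 s.2) '' (T : Set (Fin (e + 1) × K))))
    (ha : ∀ j (u : E), ∃ k, inner ℝ u a ≤ inner ℝ u (y j k)) :
    ∃ (k : Fin (e + 1) → K) (l : Fin (e + 1) → ℝ), (∀ j, 0 ≤ l j) ∧ ∑ j, l j ≤ 1 ∧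
      ∑ j, l j • y j (k j) = a := by
  classical
  let A := {k : Fin (e + 1) → K //
    ∃ l : Fin (e + 1) → ℝ, (∀ j, 0 ≤ l j) ∧ ∑ j, l j • y j (k j) = a}
  have hA : Nonempty A := by
    obtain ⟨k, l, hl, h⟩ := colorful_caratheodory_cone_s11 (by simp [hE]) y a fun j u hu =>
      (ha j u).imp fun k hk => hu.trans_le hk
    exact ⟨k, l, hl, h⟩
  choose L hL0 hLa using fun k : A => k.2
  obtain ⟨⟨k, hk⟩, hmin⟩ := Finite.exists_min fun k : A => ∑ j, L k j
  refine ⟨k, L ⟨k, hk⟩, hL0 _, ?_, hLa _⟩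
  by_contra! hgt
  set l := L ⟨k, hk⟩
  have hl0 : ∀ j, 0 ≤ l j := hL0 _
  have hla : ∑ j, l j • y j (k j) = a := hLa ⟨k, hk⟩
  have hind : LinearIndependent ℝ fun j => y j (k j) := by
    refine linearIndependent_of_generic _ a l hla fun i hmem => ?_
    refine hgen (univ.image fun j : Fin e => (i.succAbove j, k (i.succAbove j)))
      (card_image_le.trans (by simp)) ?_
    convert hmem using 2
    ext w
    simp
  let b := basisOfLinearIndependentOfCardEqFinrank hind (by simp [hE])
  let f : E →ₗ[ℝ] ℝ := b.constr ℝ fun _ => (1 : ℝ)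
  have hf : ∀ j, f (y j (k j)) = 1 := by
    intro j
    have : b j = y j (k j) := by simp [b]
    rw [← this, Module.Basis.constr_basis]
  have hfa : f a = ∑ j, l j := by
    rw [← hla, map_sum]
    simp [hf]
  have hex : ∀ j, ∃ k', f a ≤ f (y j k') := by
    intro j
    have hu : ∀ v, inner ℝ ((InnerProductSpace.toDual ℝ E).symm (LinearMap.toContinuousLinearMap f))
        v = f v := fun v => by simp
    simpa only [hu] using ha j ((InnerProductSpace.toDual ℝ E).symm
      (LinearMap.toContinuousLinearMap f))
  choose k' hk' using hex
  rw [hfa] at hk'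
  let kk : Fin (e + 1) → Bool → K := fun j c => cond c (k' j) (k j)
  have hfkk : ∀ j c, 1 ≤ f (y j (kk j c)) := by
    rintro j (_ | _)
    · exact (hf j).ge
    · exact hgt.le.trans (hk' j)
  let s : (Fin e → Bool) → Bool ⊕ Fin e → Fin (e + 1) × K := fun τ =>
    Sum.elim (fun c => (0, kk 0 c)) fun j => (j.succ, kk j.succ (τ j))
  have hs : ∀ τ i, Sum.elim (fun c => y 0 (kk 0 c)) (fun j => y j.succ (kk j.succ (τ j))) i =
      y (s τ i).1 (s τ i).2 := by
    rintro τ (c | j) <;> rfl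
  have hgen' : ∀ (τ : Fin e → Bool) (m : Bool ⊕ Fin e → ℝ),
      ∑ i, m i • Sum.elim (fun c => y 0 (kk 0 c)) (fun j => y j.succ (kk j.succ (τ j))) i = a →
      ∀ i i', m i = 0 → m i' = 0 → i = i' := by
    intro τ m hm
    simp only [hs] at hm
    exact sum_smul_mem_span_of_two_zeros (by simp; omega)
      (fun s : Fin (e + 1) × K => y s.1 s.2) a hgen (s τ) m hm
  obtain ⟨c, τ, hne, m, hm0, hmc, hma⟩ := octahedron (fun c => y 0 (kk 0 c))
    (fun (j : Fin e) c => y j.succ (kk j.succ c)) a (by simp [hE]) f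
    (fun c => zero_lt_one.trans_le (hfkk 0 c)) (fun j c => zero_lt_one.trans_le (hfkk _ c))
    (fun τ m _ hm => hgen' τ m hm) true (fun _ => false) (by
      refine ⟨Sum.elim (fun c => cond c 0 (l 0)) fun j => l j.succ, ?_, rfl, ?_⟩
      · rintro ((_ | _) | j)
        exacts [hl0 0, le_rfl, hl0 _]
      · rw [← hla, Fintype.sum_sum_type, Fin.sum_univ_succ]
        simp [kk])
  let σ : Fin (e + 1) → Bool := Fin.cons (!c) τ
  have hσ : ∃ j, σ j = true := by
    by_contra! h
    refine hne ?_
    have h0 := h 0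
    simp only [σ, Fin.cons_zero] at h0
    ext j
    · simpa using h0
    · simpa [σ] using h j.succ
  have hB : ∃ l : Fin (e + 1) → ℝ, (∀ j, 0 ≤ l j) ∧ ∑ j, l j • y j (kk j (σ j)) = a :=
    ⟨Fin.cons (m (.inl (!c))) fun j => m (.inr j), fun j => Fin.cases (hm0 _) (fun j => hm0 _) j, by
      rw [← hma, Fintype.sum_sum_type, Fin.sum_univ_succ, Fintype.sum_bool]
      cases c <;> simp [σ, hmc]⟩
  obtain ⟨n, hn0, hna, hle⟩ : ∃ n : Fin (e + 1) → ℝ, (∀ j, 0 ≤ n j) ∧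
      ∑ j, n j • y j (kk j (σ j)) = a ∧ ∑ j, l j ≤ ∑ j, n j :=
    ⟨L ⟨_, hB⟩, hL0 _, hLa ⟨_, hB⟩, hmin ⟨_, hB⟩⟩
  have hnpos : ∀ j, 0 < n j := by
    intro j
    refine (hn0 j).lt_of_ne fun h => ?_
    have hz := hgen' τ (Sum.elim (fun c' => if c' = c then 0 else n 0) fun j => n j.succ) (by
        rw [← hna, Fintype.sum_sum_type, Fin.sum_univ_succ, Fintype.sum_bool]
        cases c <;> simp [σ]) (.inl c)
    revert h
    refine Fin.cases (fun h => ?_) (fun j h => ?_) j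
    · have := hz (.inl (!c)) (by simp) (by simp [← h])
      simp at this
    · have := hz (.inr j) (by simp) (by simpa using h.symm)
      simp at this
  have hsum : ∑ j, l j = ∑ j, n j * f (y j (kk j (σ j))) := by
    rw [← hfa, ← hna, map_sum]
    simp
  obtain ⟨j₀, hj₀⟩ := hσ
  have hlt : ∑ j, n j < ∑ j, n j * f (y j (kk j (σ j))) := by
    refine sum_lt_sum (fun j _ => le_mul_of_one_le_right (hn0 j) (hfkk j _))
      ⟨j₀, mem_univ _, ?_⟩
    refine lt_mul_of_one_lt_right (hnpos j₀) ?_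
    rw [hj₀]
    exact hgt.trans_le (hk' j₀)
  exact absurd hle (not_le.2 (hlt.trans_eq hsum.symm))

end Ray

section Geometry

/-- Bang's lemma. -/
lemma exists_far_from_hyperplanes {ι E : Type*} [Fintype ι] [NormedAddCommGroup E]
    [InnerProductSpace ℝ E] (u : ι → E) (hu : ∀ i, ‖u i‖ = 1) (w : ι → ℝ) (hw : ∀ i, 0 ≤ w i) :
    ∃ a : E, ‖a‖ ≤ ∑ i, w i ∧ ∀ i, w i ≤ |inner ℝ (u i) a| := by
  classical
  let S : (ι → Bool) → E := fun ε => ∑ i, ((if ε i then 1 else -1 : ℝ) * w i) • u i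
  obtain ⟨ε, hε⟩ := Finite.exists_max fun ε => ‖S ε‖
  refine ⟨S ε, (norm_sum_le _ _).trans (sum_le_sum fun i _ => ?_), fun i => ?_⟩
  · rw [norm_smul, hu, mul_one, norm_mul, Real.norm_of_nonneg (hw i)]
    split_ifs <;> simp
  set c : ℝ := (if ε i then 1 else -1) * w i with hc
  have hflip : S (Function.update ε i (!ε i)) = S ε - (2 * c) • u i := by
    rw [eq_sub_iff_add_eq]
    simp only [S]
    rw [← add_sum_erase _ _ (mem_univ i), ← add_sum_erase univ _ (mem_univ i), add_right_comm]
    congr 1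
    · rw [← add_smul, hc, Function.update_self]
      congr 1
      cases ε i <;> simp <;> ring
    · refine sum_congr rfl fun j hj => ?_
      rw [Function.update_of_ne (ne_of_mem_erase hj)]
  have h := hε (Function.update ε i (!ε i))
  simp only [hflip] at h
  have h2 : ‖S ε - (2 * c) • u i‖ ^ 2 ≤ ‖S ε‖ ^ 2 := by gcongr
  rw [norm_sub_sq_real, inner_smul_right, norm_smul, hu, mul_one, Real.norm_eq_abs, sq_abs,
    real_inner_comm] at h2
  have hcc : c ^ 2 = w i ^ 2 := by
    rw [hc]; split_ifs <;> ring
  have h3 : w i * w i ≤ w i * |inner ℝ (u i) (S ε)| := by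
    have : c * inner ℝ (u i) (S ε) ≤ |c| * |inner ℝ (u i) (S ε)| :=
      (le_abs_self _).trans (abs_mul _ _).le
    have hcw : |c| = w i := by
      rw [← abs_of_nonneg (hw i), ← sq_eq_sq_iff_abs_eq_abs]
      simpa using hcc
    rw [hcw] at this
    nlinarith
  rcases (hw i).eq_or_lt with h0 | h0
  · rw [← h0]; positivity
  · exact le_of_mul_le_mul_left h3 h0

lemma closedBall_subset_convexHull {E : Type*} [NormedAddCommGroup E] [InnerProductSpace ℝ E]
    [FiniteDimensional ℝ E] {S : Set E} (hS : S.Finite) {r : ℝ}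
    (h : ∀ u : E, ∃ x ∈ S, r * ‖u‖ ≤ inner ℝ u x) :
    Metric.closedBall 0 r ⊆ convexHull ℝ S := by
  intro v hv
  by_contra hvS
  obtain ⟨f, c, hf, hfc⟩ := geometric_hahn_banach_closed_point (convex_convexHull ℝ S)
    (hS.isClosed_convexHull ℝ) hvS
  set n := (InnerProductSpace.toDual ℝ E).symm f
  have hn : ∀ x, f x = inner ℝ n x := fun x => by simp [n]
  simp only [hn] at hf hfc
  have hr : ‖v‖ ≤ r := by simpa using hv
  obtain ⟨x, hx, hrx⟩ := h n
  have h1 := hf x (subset_convexHull ℝ S hx)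
  have h2 := real_inner_le_norm n v
  nlinarith [norm_nonneg n]

/-- A simplex in the unit ball with a quantitative positive-spanning property. -/
lemma exists_simplex {d : ℕ} (hd : 0 < d) :
    ∃ P : Option (Fin d) → EuclideanSpace ℝ (Fin d), (∀ k, ‖P k‖ ≤ 1) ∧
      ∀ u, ∃ k, ‖u‖ ≤ √(2 * (d : ℝ) ^ 2 - 1) * inner ℝ u (P k) := by
  have hd1 : (1 : ℝ) ≤ d := by exact_mod_cast hd
  have hs0 : 0 < √(d : ℝ) := by positivity
  have hss : √(d : ℝ) * √(d : ℝ) = d := Real.mul_self_sqrt (by positivity)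
  let P : Option (Fin d) → EuclideanSpace ℝ (Fin d) := fun k =>
    k.elim (-(√(d : ℝ))⁻¹ • WithLp.toLp 2 fun _ => 1) fun i => EuclideanSpace.single i 1
  refine ⟨P, ?_, fun u => ?_⟩
  · rintro (_ | i)
    · simp [P, norm_smul, EuclideanSpace.norm_eq, abs_of_pos hs0, hs0.ne']
    · simp [P]
  obtain ⟨k, hk⟩ := Finite.exists_max fun k => inner ℝ u (P k)
  refine ⟨k, ?_⟩
  set M : ℝ := inner ℝ u (P k)
  have h1 : ∀ i, u i ≤ M := fun i => by simpa [P, EuclideanSpace.inner_single_right] using hk (some i)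
  have h2 : -∑ i, u i ≤ M * √(d : ℝ) := by
    have := hk none
    simp only [P, Option.elim, inner_smul_right, PiLp.inner_apply] at this
    simp at this
    rw [neg_le_iff_add_nonneg, ← div_eq_inv_mul, ] at this
    have h3 := mul_nonneg this hs0.le
    rw [add_mul, div_mul_cancel₀ _ hs0.ne'] at h3
    linarith
  set U : ℝ := ∑ i, (M - u i) with hU
  have hU0 : 0 ≤ U := sum_nonneg fun i _ => sub_nonneg.2 (h1 i)
  have hUe : U = d * M - ∑ i, u i := by simp [hU]
  have hUle : U ≤ M * (d + √(d : ℝ)) := by linarith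
  have hM : 0 ≤ M := by
    by_contra! h
    nlinarith
  have hsq : ∑ i, (M - u i) ^ 2 ≤ U ^ 2 := by
    exact sum_sq_le_sq_sum_of_nonneg fun i _ => sub_nonneg.2 (h1 i)
  have hnorm : ‖u‖ ^ 2 = ∑ i, (M - u i) ^ 2 - d * M ^ 2 + 2 * M * ∑ i, u i := by
    rw [EuclideanSpace.norm_sq_eq]
    simp only [sub_sq, sum_add_distrib, sum_sub_distrib, Real.norm_eq_abs, sq_abs, ← mul_sum]
    simp
    ring
  have hs1 : 2 * √(d : ℝ) ≤ d + 1 := by nlinarith [sq_nonneg (√(d : ℝ) - 1)]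
  have hs2 : 1 ≤ √(d : ℝ) := Real.one_le_sqrt.2 hd1
  have hW : U ^ 2 - 2 * M * U ≤ (M * (d + √(d : ℝ))) ^ 2 - 2 * M * (M * (d + √(d : ℝ))) := by
    have : 2 * M ≤ M * (d + √(d : ℝ)) := by nlinarith
    nlinarith
  have hfin : ‖u‖ ^ 2 ≤ (2 * (d : ℝ) ^ 2 - 1) * M ^ 2 := by
    have h5 : (d + √(d : ℝ)) ^ 2 - 2 * (d + √(d : ℝ)) + d ≤ 2 * (d : ℝ) ^ 2 - 1 := by
      nlinarith
    nlinarith [sq_nonneg M]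
  rw [← abs_of_nonneg hM, ← Real.sqrt_sq_eq_abs, ← Real.sqrt_mul (by nlinarith)]
  exact Real.le_sqrt_of_sq_le hfin

/-- Finitely many points of a set witness that its convex hull contains the unit ball, up to a
factor. -/
lemma exists_finite_witness {d : ℕ} (hd : 0 < d) {X : Set (EuclideanSpace ℝ (Fin d))}
    (hX : Metric.closedBall 0 1 ⊆ convexHull ℝ X) :
    ∃ y : Option (Fin d) × Fin (d + 1) → EuclideanSpace ℝ (Fin d), (∀ κ, y κ ∈ X) ∧
      ∀ u, ∃ κ, ‖u‖ ≤ √(2 * (d : ℝ) ^ 2 - 1) * inner ℝ u (y κ) := by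
  obtain ⟨P, hP, hPu⟩ := exists_simplex hd
  have key : ∀ k, ∃ z : Fin (d + 1) → EuclideanSpace ℝ (Fin d), (∀ i, z i ∈ X) ∧
      ∀ u, ∃ i, inner ℝ u (P k) ≤ inner ℝ u (z i) := by
    intro k
    obtain ⟨ι, _, z, w, hz, hind, hw0, hw1, hwz⟩ :=
      eq_pos_convex_span_of_mem_convexHull (hX (by simpa using hP k))
    have hcard : Fintype.card ι ≤ d + 1 := hind.card_le_finrank_succ.trans
      (add_le_add_left ((Submodule.finrank_le _).trans (by simp)) 1)
    have hne : Nonempty ι := by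
      by_contra h
      rw [not_nonempty_iff] at h
      simp at hw1
    obtain ⟨g⟩ : Nonempty (ι ↪ Fin (d + 1)) := Function.Embedding.nonempty_of_card_le (by simpa)
    refine ⟨fun i => z (Function.invFun g i), fun i => hz ⟨_, rfl⟩, fun u => ?_⟩
    by_contra! h
    have h' : ∀ i, inner ℝ u (z i) < inner ℝ u (P k) := fun i => by
      simpa [Function.leftInverse_invFun g.injective i] using h (g i)
    have : ∑ i, w i * inner ℝ u (z i) < ∑ i, w i * inner ℝ u (P k) :=
      sum_lt_sum_of_nonempty univ_nonempty fun i _ => by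
        have := hw0 i
        have := h' i
        gcongr
    rw [← sum_mul, hw1, one_mul, ← hwz, inner_sum] at this
    simp [inner_smul_right] at this
  choose z hz hzu using key
  refine ⟨fun κ => z κ.1 κ.2, fun κ => hz _ _, fun u => ?_⟩
  obtain ⟨k, hk⟩ := hPu u
  obtain ⟨i, hi⟩ := hzu k u
  exact ⟨(k, i), hk.trans (by gcongr)⟩

end Geometry

section Steinitz

variable {E : Type*} [NormedAddCommGroup E] [InnerProductSpace ℝ E] [FiniteDimensional ℝ E]

lemma exists_unit_normal {e : ℕ} (hE : Module.finrank ℝ E = e + 1) {S : Type*} (T : Finset S)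
    (hT : T.card ≤ e) (y : S → E) :
    ∃ u : E, ‖u‖ = 1 ∧ ∀ v ∈ Submodule.span ℝ (y '' (T : Set S)), inner ℝ u v = 0 := by
  classical
  set V := Submodule.span ℝ (y '' (T : Set S))
  have hV : Module.finrank ℝ V ≤ e := by
    have := finrank_span_finset_le_card (R := ℝ) (T.image y)
    rw [Finset.coe_image] at this
    exact this.trans (card_image_le.trans hT)
  have hne : Vᗮ ≠ ⊥ := by
    intro h
    have := Submodule.finrank_add_finrank_orthogonal V
    rw [h, finrank_bot, hE] at this
    omega
  obtain ⟨u, hu, hu0⟩ := Submodule.exists_mem_ne_zero_of_ne_bot hne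
  refine ⟨‖u‖⁻¹ • u, by rw [norm_smul]; simp [hu0], fun v hv => ?_⟩
  rw [real_inner_smul_left, Submodule.inner_left_of_mem_orthogonal hv hu, mul_zero]

/-- Two-colour selection: each of the `e + 1` colour classes contributes one vector from each of
two families, and the chosen vectors have a ball in their convex hull. -/
theorem two_family_selection {e : ℕ} {K : Type*} [Fintype K] [Nonempty K]
    (hE : Module.finrank ℝ E = e + 1) (y y' : Fin (e + 1) → K → E) {C r : ℝ} (hC : 0 < C)
    (hr : 0 < r) (hrC : 3 * r * C * ((e + 1) * (Fintype.card K : ℝ) ^ e) < 1)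
    (hy : ∀ j u, ∃ k, ‖u‖ ≤ C * inner ℝ u (y j k))
    (hy' : ∀ j u, ∃ k, ‖u‖ ≤ C * inner ℝ u (y' j k)) :
    ∃ k k' : Fin (e + 1) → K, ∀ u : E,
      (∃ j, r * ‖u‖ ≤ inner ℝ u (y j (k j))) ∨ ∃ j, r * ‖u‖ ≤ inner ℝ u (y' j (k' j)) := by
  classical
  let S := Fin (e + 1) × K
  let G := {T : Finset S // T.card ≤ e}
  let I := (Fin (e + 1) × (Fin e → K)) ⊕ (G ⊕ G)
  let F : Fin (e + 1) × (Fin e → K) → Finset S := fun p =>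
    univ.image fun l => (p.1.succAbove l, p.2 l)
  have hF : ∀ p, (F p).card ≤ e := fun p => card_image_le.trans (by simp)
  choose nm hnm1 hnm using fun p => exists_unit_normal hE (F p) (hF p) fun s : S => y s.1 s.2
  choose ng hng1 hng using fun T : G => exists_unit_normal hE T.1 T.2 fun s : S => y s.1 s.2
  choose ng' hng1' hng' using fun T : G => exists_unit_normal hE T.1 T.2 fun s : S => y' s.1 s.2
  set N : ℝ := (e + 1) * (Fintype.card K : ℝ) ^ e with hN
  obtain ⟨δ, hδ, hδN⟩ : ∃ δ : ℝ, 0 < δ ∧ 3 * r * C * N + δ * (N + (Fintype.card G +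
      Fintype.card G)) ≤ 1 := by
    have hpos : 0 < N + ((Fintype.card G : ℝ) + Fintype.card G) := by positivity
    refine ⟨(1 - 3 * r * C * N) / (N + (Fintype.card G + Fintype.card G)),
      div_pos (sub_pos.2 hrC) hpos, ?_⟩
    rw [div_mul_cancel₀ _ hpos.ne']
    linarith
  obtain ⟨a, ha, hab⟩ := exists_far_from_hyperplanes
    (Sum.elim nm (Sum.elim ng ng') : I → E) (by rintro (_ | _ | _) <;> simp [*])
    (Sum.elim (fun _ => 3 * r * C + δ) fun _ => δ)
    (by rintro (_ | _ | _) <;> simp <;> positivity)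
  have ha1 : ‖a‖ ≤ 1 := by
    refine ha.trans (le_trans (le_of_eq ?_) hδN)
    simp [hN]
    ring
  have hmain : ∀ p, 3 * r * C + δ ≤ |inner ℝ (nm p) a| := fun p => hab (.inl p)
  have hgen : ∀ T : G, inner ℝ (ng T) a ≠ 0 := fun T =>
    abs_pos.1 (hδ.trans_le (hab (.inr (.inl T))))
  have hgen' : ∀ T : G, inner ℝ (ng' T) a ≠ 0 := fun T =>
    abs_pos.1 (hδ.trans_le (hab (.inr (.inr T))))
  obtain ⟨b, hb⟩ : ∃ b, b = C⁻¹ • a := ⟨_, rfl⟩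
  have hCb : a = C • b := by rw [hb, smul_inv_smul₀ hC.ne']
  have hbn : ‖b‖ ≤ C⁻¹ := by
    rw [hb, norm_smul, Real.norm_of_nonneg (by positivity)]
    exact mul_le_of_le_one_right (by positivity) ha1
  have hbu : ∀ u : E, |inner ℝ u b| ≤ C⁻¹ * ‖u‖ := fun u =>
    (abs_real_inner_le_norm u b).trans (by rw [mul_comm]; gcongr)
  have hbg : ∀ T : Finset S, T.card ≤ e →
      b ∉ Submodule.span ℝ ((fun s : S => y s.1 s.2) '' (T : Set S)) := fun T hT h =>
    hgen ⟨T, hT⟩ (by rw [hCb, inner_smul_right, hng ⟨T, hT⟩ b h, mul_zero])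
  have hbg' : ∀ T : Finset S, T.card ≤ e →
      -b ∉ Submodule.span ℝ ((fun s : S => y' s.1 s.2) '' (T : Set S)) := fun T hT h =>
    hgen' ⟨T, hT⟩ (by
      rw [hCb, inner_smul_right, hng' ⟨T, hT⟩ b (by simpa using neg_mem h), mul_zero])
  obtain ⟨k, μ, hμ0, hμ1, hμb⟩ := exists_rainbow_beyond hE y b hbg fun j u => by
    obtain ⟨k, hk⟩ := hy j u
    refine ⟨k, (le_abs_self _).trans ((hbu u).trans ?_)⟩
    rwa [inv_mul_le_iff₀ hC]
  obtain ⟨k', μ', hμ0', hμ1', hμb'⟩ := exists_rainbow_beyond hE y' (-b) hbg' fun j u => by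
    obtain ⟨k, hk⟩ := hy' j u
    refine ⟨k, le_trans ?_ ((hbu u).trans ((inv_mul_le_iff₀ hC).2 hk))⟩
    rw [inner_neg_right]
    exact neg_le_abs _
  refine ⟨k, k', fun u => ?_⟩
  by_contra! hcon
  obtain ⟨h1, h2⟩ := hcon
  have hu0 : 0 < ‖u‖ := by
    rw [norm_pos_iff]
    rintro rfl
    simpa using h1 0
  set x := fun j => y j (k j)
  have hmem : ∀ i (l : Fin e), x (i.succAbove l) ∈ Submodule.span ℝ
      ((fun s : S => y s.1 s.2) '' (F (i, fun l => k (i.succAbove l)) : Set S)) := fun i l =>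
    Submodule.subset_span ⟨(i.succAbove l, k (i.succAbove l)), by simp [F], rfl⟩
  have hind : LinearIndependent ℝ x :=
    linearIndependent_of_generic _ b μ hμb fun i h =>
      hbg _ (hF (i, fun l => k (i.succAbove l))) (Submodule.span_le.2
        (by rintro _ ⟨l, rfl⟩; exact hmem i l) h)
  let B := basisOfLinearIndependentOfCardEqFinrank hind (by simp [hE])
  set ν := B.repr ((3 * r + δ / C) • u)
  have hν : ∑ j, ν j • x j = (3 * r + δ / C) • u := by
    have hBx : ⇑B = x := coe_basisOfLinearIndependentOfCardEqFinrank _ _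
    simpa only [hBx] using B.sum_repr ((3 * r + δ / C) • u)
  have hproj : ∀ (l : Fin (e + 1) → ℝ) i,
      inner ℝ (nm (i, fun l => k (i.succAbove l))) (∑ j, l j • x j) =
        l i * inner ℝ (nm (i, fun l => k (i.succAbove l))) (x i) := by
    intro l i
    rw [Fin.sum_univ_succAbove _ i, inner_add_right, inner_sum, inner_smul_right,
      sum_eq_zero, add_zero]
    intro j _
    rw [inner_smul_right, hnm _ _ (hmem i j), mul_zero]
  have hνμ : ∀ i, |ν i| ≤ μ i * ‖u‖ := by
    intro i
    set n := nm (i, fun l => k (i.succAbove l))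
    have hA : 3 * r + δ / C ≤ μ i * |inner ℝ n (x i)| := by
      rw [← abs_of_nonneg (hμ0 i), ← abs_mul, ← hproj, hμb, ← mul_le_mul_iff_right₀ hC,
        ← abs_of_pos hC, ← abs_mul, ← inner_smul_right, abs_of_pos hC, ← hCb]
      refine le_trans (le_of_eq ?_) (hmain _)
      field_simp
    have hB : |ν i| * |inner ℝ n (x i)| ≤ (3 * r + δ / C) * ‖u‖ := by
      rw [← abs_mul, ← hproj, hν, inner_smul_right, abs_mul, abs_of_pos (by positivity)]
      gcongr
      simpa [n, hnm1] using abs_real_inner_le_norm n u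
    have hpos : 0 < |inner ℝ n (x i)| := by
      refine abs_pos.2 fun h => ?_
      rw [h, abs_zero, mul_zero] at hA
      have : 0 < 3 * r + δ / C := by positivity
      linarith
    refine le_of_mul_le_mul_right (hB.trans ?_) hpos
    nlinarith
  have hS1 : ∑ j, (μ j * ‖u‖ + ν j) * inner ℝ u (x j) =
      ‖u‖ * inner ℝ u b + (3 * r + δ / C) * ‖u‖ ^ 2 := by
    have e1 : inner ℝ u (‖u‖ • ∑ j, μ j • x j + ∑ j, ν j • x j) =
        ‖u‖ * inner ℝ u b + (3 * r + δ / C) * ‖u‖ ^ 2 := by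
      rw [hμb, hν, inner_add_right, inner_smul_right, inner_smul_right,
        real_inner_self_eq_norm_sq]
    rw [← e1, smul_sum, ← sum_add_distrib, inner_sum]
    refine sum_congr rfl fun j _ => ?_
    rw [smul_smul, ← add_smul, inner_smul_right, mul_comm ‖u‖]
  have hS2 : ∑ j, (μ j * ‖u‖ + ν j) * inner ℝ u (x j) ≤ ∑ j, 2 * μ j * ‖u‖ * (r * ‖u‖) := by
    refine sum_le_sum fun j _ => ?_
    have := abs_le.1 (hνμ j)
    have hru : 0 < r * ‖u‖ := by positivity
    calc _ ≤ (μ j * ‖u‖ + ν j) * (r * ‖u‖) :=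
          mul_le_mul_of_nonneg_left (h1 j).le (by linarith)
      _ ≤ _ := mul_le_mul_of_nonneg_right (by linarith) hru.le
  have hS3 : -inner ℝ u b ≤ r * ‖u‖ := by
    rw [← inner_neg_right, ← hμb', inner_sum]
    calc _ ≤ ∑ j, μ' j * (r * ‖u‖) := sum_le_sum fun j _ => by
            rw [inner_smul_right]
            exact mul_le_mul_of_nonneg_left (h2 j).le (hμ0' j)
      _ ≤ r * ‖u‖ := by
        rw [← sum_mul]
        exact mul_le_of_le_one_left (by positivity) hμ1'
  have hS4 : ∑ j, 2 * μ j * ‖u‖ * (r * ‖u‖) ≤ 2 * r * ‖u‖ ^ 2 := by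
    have : ∑ j, 2 * μ j * ‖u‖ * (r * ‖u‖) = (∑ j, μ j) * (2 * r * ‖u‖ ^ 2) := by
      rw [sum_mul]
      exact sum_congr rfl fun j _ => by ring
    rw [this]
    exact mul_le_of_le_one_left (by positivity) hμ1
  have hδC : 0 < δ / C * ‖u‖ ^ 2 := by positivity
  nlinarith

end Steinitz

section Assembly

open scoped Pointwise

lemma radius_bound {e : ℕ} (he : 1 ≤ e) :
    3 * (Real.pi / Real.exp 1 ^ 2 * ((e + 1 : ℕ) : ℝ) ^ (-(2 * ((e + 1 : ℕ) : ℤ)) - 2)) *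
      √(2 * ((e + 1 : ℕ) : ℝ) ^ 2 - 1) *
      ((e + 1) * (Fintype.card (Option (Fin (e + 1)) × Fin (e + 1 + 1)) : ℝ) ^ e) < 1 := by
  have hpi := Real.pi_lt_d4
  have hpi0 := Real.pi_pos
  have hzp : ((e + 1 : ℕ) : ℝ) ^ (-(2 * ((e + 1 : ℕ) : ℤ)) - 2) =
      (((e + 1 : ℕ) : ℝ) ^ (2 * (e + 1) + 2))⁻¹ := by
    rw [← zpow_natCast, ← zpow_neg]
    congr 1
  rw [hzp]
  simp only [Fintype.card_prod, Fintype.card_option, Fintype.card_fin]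
  rcases he.eq_or_lt with rfl | he
  · have h7 : √(7 : ℝ) < 2.6458 := by
      rw [Real.sqrt_lt' (by norm_num)]; norm_num
    have hexp : (7.389 : ℝ) < Real.exp 1 ^ 2 := by
      have := Real.exp_one_gt_d9
      nlinarith
    have h1 : Real.pi / Real.exp 1 ^ 2 < 3.1416 / 7.389 := by gcongr
    have h70 := Real.sqrt_nonneg (7 : ℝ)
    have h10 : 0 < Real.pi / Real.exp 1 ^ 2 := by positivity
    generalize Real.pi / Real.exp 1 ^ 2 = q at h1 h10 ⊢
    norm_num at h1 ⊢
    nlinarith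
  · obtain ⟨D, hD⟩ : ∃ D : ℝ, D = ((e + 1 : ℕ) : ℝ) := ⟨_, rfl⟩
    have hD3 : 3 ≤ D := by rw [hD]; exact_mod_cast Nat.succ_le_succ he
    have hDe : (e : ℝ) + 1 = D := by rw [hD]; push_cast; rfl
    have hC : √(2 * D ^ 2 - 1) ≤ 3 / 2 * D := by
      rw [Real.sqrt_le_left (by positivity)]; nlinarith
    have hexp : (D + 1) ^ (2 * (e + 1)) ≤ Real.exp 1 ^ 2 * D ^ (2 * (e + 1)) := by
      have h1 : D⁻¹ + 1 ≤ Real.exp D⁻¹ := Real.add_one_le_exp _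
      have h2 : D + 1 ≤ Real.exp D⁻¹ * D := by
        calc D + 1 = (D⁻¹ + 1) * D := by field_simp; ring
          _ ≤ _ := by gcongr
      calc (D + 1) ^ (2 * (e + 1)) ≤ (Real.exp D⁻¹ * D) ^ (2 * (e + 1)) := by gcongr
        _ = Real.exp 1 ^ 2 * D ^ (2 * (e + 1)) := by
          rw [mul_pow, ← Real.exp_nat_mul, ← Real.exp_nat_mul]
          congr 2
          push_cast
          rw [hDe]
          field_simp
    rw [← hD, hDe]
    push_cast
    rw [hDe]
    have hE : 0 < Real.exp 1 ^ 2 := by positivity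
    have hDp : 0 < D ^ (2 * (e + 1)) := by positivity
    have hD1 : 0 < (D + 1) ^ 2 := by positivity
    have hpw : ((D + 1) * (D + 1)) ^ e ≤ Real.exp 1 ^ 2 * D ^ (2 * (e + 1)) / (D + 1) ^ 2 := by
      rw [le_div_iff₀ hD1]
      refine le_trans (le_of_eq ?_) hexp
      rw [← sq, ← pow_mul, ← pow_add, mul_add_one]
    calc _ ≤ 3 * (Real.pi / Real.exp 1 ^ 2 * (D ^ (2 * (e + 1) + 2))⁻¹) * (3 / 2 * D) *
          (D * (Real.exp 1 ^ 2 * D ^ (2 * (e + 1)) / (D + 1) ^ 2)) := by gcongr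
      _ = 9 / 2 * Real.pi / (D + 1) ^ 2 := by
        rw [pow_add D]
        field_simp
        ring
      _ < 1 := by
        rw [div_lt_one hD1]
        nlinarith

/-- Quantitative colourful Steinitz theorem with two families. -/
theorem exists_ball_of_two_families {d : ℕ} (hd : 0 < d)
    (X X' : Fin d → Set (EuclideanSpace ℝ (Fin d)))
    (hX : ∀ j, Metric.closedBall 0 1 ⊆ convexHull ℝ (X j))
    (hX' : ∀ j, Metric.closedBall 0 1 ⊆ convexHull ℝ (X' j)) :
    ∃ x x' : Fin d → EuclideanSpace ℝ (Fin d), (∀ j, x j ∈ X j) ∧ (∀ j, x' j ∈ X' j) ∧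
      Metric.closedBall 0 ((Real.pi / Real.exp 1 ^ 2) * (d : ℝ) ^ (-(2 * (d : ℤ)) - 2)) ⊆
        convexHull ℝ (Set.range x ∪ Set.range x') := by
  obtain ⟨e, rfl⟩ := Nat.exists_eq_add_one.2 hd
  choose y hyX hy using fun j => exists_finite_witness hd (hX j)
  choose y' hyX' hy' using fun j => exists_finite_witness hd (hX' j)
  have hfin : ∀ x x' : Fin (e + 1) → EuclideanSpace ℝ (Fin (e + 1)),
    (Set.range x ∪ Set.range x').Finite := fun x x' =>
      (Set.finite_range x).union (Set.finite_range x')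
  rcases Nat.eq_zero_or_pos e with rfl | he
  · let v : EuclideanSpace ℝ (Fin (0 + 1)) := EuclideanSpace.single 0 1
    have hv : ‖v‖ = 1 := by simp [v]
    obtain ⟨k, hk⟩ := hy 0 v
    obtain ⟨k', hk'⟩ := hy' 0 (-v)
    have hs : √(2 * ((0 + 1 : ℕ) : ℝ) ^ 2 - 1) = 1 := by norm_num
    rw [hs, hv, one_mul] at hk
    rw [hs, norm_neg, hv, one_mul] at hk'
    have hr : Real.pi / Real.exp 1 ^ 2 * ((0 + 1 : ℕ) : ℝ) ^ (-(2 * ((0 + 1 : ℕ) : ℤ)) - 2) ≤ 1 := by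
      simp only [zero_add, Nat.cast_one, one_zpow, mul_one]
      rw [div_le_one (by positivity)]
      nlinarith [Real.pi_lt_d4, Real.exp_one_gt_d9]
    refine ⟨fun j => y j k, fun j => y' j k', fun j => hyX _ _, fun j => hyX' _ _,
      (Metric.closedBall_subset_closedBall hr).trans
        (closedBall_subset_convexHull (hfin _ _) fun u => ?_)⟩
    have hu : u = u 0 • v := by
      ext i
      fin_cases i
      simp [v]
    rw [hu, norm_smul, hv, mul_one, one_mul]
    rcases le_total 0 (u 0) with h | h
    · refine ⟨_, .inl ⟨0, rfl⟩, ?_⟩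
      rw [real_inner_smul_left, Real.norm_of_nonneg h]
      exact le_mul_of_one_le_right h hk
    · refine ⟨_, .inr ⟨0, rfl⟩, ?_⟩
      rw [inner_neg_left] at hk'
      rw [real_inner_smul_left, Real.norm_of_nonpos h]
      nlinarith
  · have hC : 0 < √(2 * ((e + 1 : ℕ) : ℝ) ^ 2 - 1) := by
      refine Real.sqrt_pos.2 ?_
      have : (0 : ℝ) ≤ e := e.cast_nonneg
      push_cast
      nlinarith
    obtain ⟨k, k', hkk⟩ := two_family_selection (by simp) y y' hC (by positivity)
      (radius_bound he) hy hy'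
    refine ⟨fun j => y j (k j), fun j => y' j (k' j), fun j => hyX _ _, fun j => hyX' _ _,
      closedBall_subset_convexHull (hfin _ _) fun u => ?_⟩
    rcases hkk u with ⟨j, hj⟩ | ⟨j, hj⟩
    exacts [⟨_, .inl ⟨j, rfl⟩, hj⟩, ⟨_, .inr ⟨j, rfl⟩, hj⟩]

lemma closedBall_subset_convexHull_combinations {J E : Type*} [NormedAddCommGroup E]
    [NormedSpace ℝ E] (T : J → Set E) (c : J → E)
    (hT : ∀ j, Metric.closedBall (c j) 1 ⊆ convexHull ℝ (T j)) (s : Finset J) (l : J → ℝ)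
    (hs : ∑ j ∈ s, l j = 1) (p : E) (hp : ∑ j ∈ s, l j • c j = p) :
    Metric.closedBall 0 1 ⊆
      convexHull ℝ {x : E | ∃ t : J → E, (∀ j, t j ∈ T j) ∧ ∑ j ∈ s, l j • t j = x + p} := by
  classical
  intro v hv
  have hne : ∀ j, (T j).Nonempty := fun j =>
    convexHull_nonempty_iff.1 ⟨_, hT j (Metric.mem_closedBall_self zero_le_one)⟩
  choose t₀ ht₀ using hne
  have h1 : v + p ∈ convexHull ℝ (∑ j ∈ s, l j • T j) := by
    rw [convexHull_sum, Set.mem_finsetSum]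
    refine ⟨fun j => l j • (v + c j), fun {j} _ => ?_, ?_⟩
    · rw [convexHull_smul]
      exact Set.smul_mem_smul_set (hT j (by simpa using hv))
    · simp only [smul_add, sum_add_distrib, ← sum_smul, hs, one_smul, hp]
  set X := {x : E | ∃ t : J → E, (∀ j, t j ∈ T j) ∧ ∑ j ∈ s, l j • t j = x + p}
  have h2 : ∑ j ∈ s, l j • T j ⊆ (fun w => w + -p) ⁻¹' convexHull ℝ X := by
    intro w hw
    rw [Set.mem_finsetSum] at hw
    obtain ⟨g, hg, rfl⟩ := hw
    choose! t ht htg using fun j (hj : j ∈ s) => hg hj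
    refine subset_convexHull ℝ X ⟨fun j => if j ∈ s then t j else t₀ j, fun j => ?_, ?_⟩
    · dsimp only
      split_ifs with h
      exacts [ht j h, ht₀ j]
    · rw [neg_add_cancel_right]
      exact sum_congr rfl fun j hj => by simpa [hj] using htg j hj
  have h3 := convexHull_min h2 ((convex_convexHull ℝ X).translate_preimage_left _) h1
  simpa using h3

end Assembly

end Tools

/-- Continuous quantitative Tverberg theorem (first part of Theorem 4.1):
with `n = (2dm − 1)(d + 1) + 1` sets `T_i ⊆ ℝ^d` whose convex hulls each contain a unit
ball, one can choose `t_i ∈ T_i` and partition the chosen points into `m` parts whose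
convex hulls have a common ball of radius `(π/e²)·d^(−2d−2)`. -/
theorem continuous_quantitative_tverberg
    (d m : ℕ) (hd : 0 < d) (hm : 0 < m)
    (T : Fin ((2 * d * m - 1) * (d + 1) + 1) → Set (EuclideanSpace ℝ (Fin d)))
    (hT : ∀ i, ∃ c : EuclideanSpace ℝ (Fin d),
      Metric.closedBall c 1 ⊆ convexHull ℝ (T i)) :
    ∃ t : Fin ((2 * d * m - 1) * (d + 1) + 1) → EuclideanSpace ℝ (Fin d),
      (∀ i, t i ∈ T i) ∧
      ∃ A : Fin m → Set (Fin ((2 * d * m - 1) * (d + 1) + 1)),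
        (∀ j, ∃! k, j ∈ A k) ∧
        ∃ p : EuclideanSpace ℝ (Fin d),
          Metric.closedBall p ((Real.pi / Real.exp 1 ^ 2) * (d : ℝ) ^ (-(2 * (d : ℤ)) - 2)) ⊆
            ⋂ k, convexHull ℝ (t '' A k) := by
  classical
  choose c hc using hT
  have hdm : 0 < 2 * d * m := by positivity
  obtain ⟨k, l, p, hl0, hlp⟩ := tverberg (J := Fin ((2 * d * m - 1) * (d + 1) + 1))
    (Q := Fin (2 * d * m - 1)) (D := Fin d) (by simp) c
  have q : Option (Fin (2 * d * m - 1)) ≃ Fin m × Bool × Fin d :=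
    Fintype.equivOfCardEq (by
      simp only [Fintype.card_option, Fintype.card_prod, Fintype.card_fin, Fintype.card_bool]
      rw [Nat.sub_add_cancel hdm]
      ring)
  have hS := fun r => closedBall_subset_convexHull_combinations T c hc
    (Finset.univ.filter fun j => k j = r) l (hlp r).1 p (hlp r).2
  have hsel := fun g : Fin m => exists_ball_of_two_families hd _ _
    (fun j => hS (q.symm (g, false, j))) (fun j => hS (q.symm (g, true, j)))
  choose x x' hx hx' hball using hsel
  have hpick : ∀ r, ∃ t : Fin ((2 * d * m - 1) * (d + 1) + 1) → EuclideanSpace ℝ (Fin d),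
      (∀ j, t j ∈ T j) ∧ ∑ j with k j = r, l j • t j =
        cond (q r).2.1 (x' (q r).1 (q r).2.2) (x (q r).1 (q r).2.2) + p := by
    intro r
    obtain ⟨⟨g, b, j⟩, rfl⟩ := q.symm.surjective r
    rw [Equiv.apply_symm_apply]
    cases b
    exacts [hx g j, hx' g j]
  choose t ht hts using hpick
  let A : Fin m → Set (Fin ((2 * d * m - 1) * (d + 1) + 1)) := fun g => {i | (q (k i)).1 = g}
  have hmem : ∀ r, cond (q r).2.1 (x' (q r).1 (q r).2.2) (x (q r).1 (q r).2.2) + p ∈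
      convexHull ℝ ((fun i => t (k i) i) '' A (q r).1) := by
    intro r
    rw [← hts]
    refine (convex_convexHull ℝ _).sum_mem (fun j _ => hl0 j) (hlp r).1 fun j hj => ?_
    obtain rfl := (Finset.mem_filter.1 hj).2
    exact subset_convexHull ℝ _ ⟨j, rfl, rfl⟩
  refine ⟨fun i => t (k i) i, fun i => ht _ i, A, fun i => ⟨(q (k i)).1, rfl, fun g hg => hg.symm⟩,
    p, Set.subset_iInter fun g v hv => ?_⟩
  have hv0 := hball g (show v - p ∈ _ by simpa [dist_eq_norm] using hv)
  have hsub : Set.range (x g) ∪ Set.range (x' g) ⊆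
      (fun w => w + p) ⁻¹' convexHull ℝ ((fun i => t (k i) i) '' A g) := by
    rintro _ (⟨j, rfl⟩ | ⟨j, rfl⟩)
    · simpa using hmem (q.symm (g, false, j))
    · simpa using hmem (q.symm (g, true, j))
  simpa using convexHull_min hsub ((convex_convexHull ℝ _).translate_preimage_left _) hv0
end
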